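/- arXiv:1004.1478 — 8 statements merged into one kernel-verified Lean document; each statement's English description precedes it below -/
import Mathlib

section
/- Let p ≥ 1 and let x : [0,1] → ℝ be continuous with x(0) = 0. Suppose there are points 0 = s_0 < s_1 < ⋯ < s_n = 1 such that x is monotone nondecreasing on each interval [s_{2i}, s_{2i+1}] and monotone nonincreasing on each interval [s_{2i+1}, s_{2i+2}] (for all indices for which these intervals lie in [0,1]), and suppose x is jog-free, i.e. for every odd index j with 1 ≤ j ≤ n one has x(s_j) = sup_{t ∈ [s_j,1]} x(t), and for every even index j with 2 ≤ j ≤ n one has x(s_j) = inf_{t ∈ [s_j,1]} x(t). Then the p-variation of x equals the sum over its extrema: sup over all finite partitions 0 = t_0 < t_1 < ⋯ < t_N = 1 of Σ_{i=1}^N |x(t_i) − x(t_{i−1})|^p is equal to Σ_{j=1}^n |x(s_j) − x(s_{j−1})|^p. -/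
open Set Finset

/-- The set of `p`-variation sums of `f : [0,1] → ℝ` over finite partitions
`0 = t₀ < t₁ < ⋯ < t_N = 1`. -/
def varSums (p : ℝ) {E : Type*} [NormedAddCommGroup E] (f : ℝ → E) : Set ℝ :=
  {S | ∃ (N : ℕ) (t : ℕ → ℝ), t 0 = 0 ∧ t N = 1 ∧ (∀ i < N, t i < t (i + 1)) ∧
    S = ∑ i ∈ Finset.range N, ‖f (t (i + 1)) - f (t i)‖ ^ p}

theorem rpow_add_rpow_le_of_add_le {p a b c : ℝ} (hp : 1 ≤ p) (ha : 0 ≤ a) (hb : 0 ≤ b)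
    (h : a + b ≤ c) : a ^ p + b ^ p ≤ c ^ p :=
  (Real.add_rpow_le_rpow_add ha hb hp).trans
    (Real.rpow_le_rpow (add_nonneg ha hb) h (by linarith))

theorem abs_sub_eq_of_neg_one_pow_mul_le {k : ℕ} {a b : ℝ}
    (h : (-1) ^ k * a ≤ (-1) ^ k * b) : |b - a| = (-1) ^ k * b - (-1) ^ k * a := by
  have hnonneg : 0 ≤ (-1) ^ k * (b - a) := by linarith
  rw [← mul_sub, ← abs_of_nonneg hnonneg, abs_mul, abs_neg_one_pow, one_mul]

/-- The value of the variation sum that starts at `t` and then runs through `s (j + 1), …, s n`. -/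
noncomputable def tailVariation (p : ℝ) (x : ℝ → ℝ) (s : ℕ → ℝ) (n j : ℕ) (t : ℝ) : ℝ :=
  |x (s (j + 1)) - x t| ^ p + ∑ i ∈ Finset.Ico (j + 1) n, |x (s (i + 1)) - x (s i)| ^ p

theorem le_of_forall_lt_succ {s : ℕ → ℝ} {n : ℕ} (hincr : ∀ i < n, s i < s (i + 1))
    {i j : ℕ} (hij : i ≤ j) (hj : j ≤ n) : s i ≤ s j := by
  induction j, hij using Nat.le_induction with
  | base => exact le_rfl
  | succ k _ ih => exact (ih (by omega)).trans (hincr k (by omega)).le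

/-- Passing through an intermediate point `u` does not increase the variation sum. Here `(-1) ^ j`
is the direction in which `x` moves on `[s j, s (j + 1)]`. -/
theorem rpow_add_tailVariation_le {p : ℝ} (hp : 1 ≤ p) {x : ℝ → ℝ} {n : ℕ} {s : ℕ → ℝ}
    (hsn : s n = 1) (hincr : ∀ i < n, s i < s (i + 1))
    (hmono : ∀ j < n, MonotoneOn (fun t => (-1) ^ j * x t) (Icc (s j) (s (j + 1))))
    (hdom : ∀ j < n, ∀ t ∈ Icc (s (j + 1)) 1, (-1) ^ j * x t ≤ (-1) ^ j * x (s (j + 1)))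
    {j k : ℕ} (hjk : j ≤ k) (hk : k < n) {t u : ℝ} (ht : t ∈ Icc (s j) (s (j + 1)))
    (hu : u ∈ Icc (s k) (s (k + 1))) (htu : t ≤ u) :
    |x u - x t| ^ p + tailVariation p x s n k u ≤ tailVariation p x s n j t := by
  have hp0 : 0 ≤ p := by linarith
  have hright : ∀ i < n, s (i + 1) ∈ Icc (s i) (s (i + 1)) := fun i hi =>
    ⟨(hincr i hi).le, le_rfl⟩
  have hleft : ∀ i < n, s i ∈ Icc (s i) (s (i + 1)) := fun i hi =>
    ⟨le_rfl, (hincr i hi).le⟩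
  have hj : j < n := by omega
  have ht1 : (-1) ^ j * x t ≤ (-1) ^ j * x (s (j + 1)) := hmono j hj ht (hright j hj) ht.2
  have hu1 : (-1) ^ k * x u ≤ (-1) ^ k * x (s (k + 1)) := hmono k hk hu (hright k hk) hu.2
  unfold tailVariation
  rcases hjk.eq_or_lt with rfl | hlt
  · have htu1 : (-1) ^ j * x t ≤ (-1) ^ j * x u := hmono j hj ht hu htu
    have := rpow_add_rpow_le_of_add_le (c := |x (s (j + 1)) - x t|) hp (abs_nonneg (x u - x t))
      (abs_nonneg (x (s (j + 1)) - x u)) (by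
        rw [abs_sub_eq_of_neg_one_pow_mul_le htu1, abs_sub_eq_of_neg_one_pow_mul_le hu1,
          abs_sub_eq_of_neg_one_pow_mul_le ht1]
        linarith)
    linarith
  have hu0 : (-1) ^ k * x (s k) ≤ (-1) ^ k * x u := hmono k hk (hleft k hk) hu hu.1
  have hsk : s (j + 1) ≤ s k := le_of_forall_lt_succ hincr hlt hk.le
  have hu_one : u ≤ 1 := hu.2.trans (hsn ▸ le_of_forall_lt_succ hincr hk le_rfl)
  have hud : (-1) ^ j * x u ≤ (-1) ^ j * x (s (j + 1)) := hdom j hj u ⟨hsk.trans hu.1, hu_one⟩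
  have hlast : |x (s (k + 1)) - x u| ^ p ≤ |x (s (k + 1)) - x (s k)| ^ p :=
    Real.rpow_le_rpow (abs_nonneg _)
      (by
        rw [abs_sub_eq_of_neg_one_pow_mul_le hu1,
          abs_sub_eq_of_neg_one_pow_mul_le (hu0.trans hu1)]
        linarith) hp0
  have hterm : ∀ i, 0 ≤ |x (s (i + 1)) - x (s i)| ^ p := fun i =>
    Real.rpow_nonneg (abs_nonneg _) p
  have hsplit := Finset.sum_Ico_consecutive (fun i => |x (s (i + 1)) - x (s i)| ^ p) hlt hk.le
  rw [Finset.sum_eq_sum_Ico_succ_bot hk] at hsplit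
  rcases le_total ((-1) ^ j * x t) ((-1) ^ j * x u) with hle | hle
  · have hfirst : |x u - x t| ^ p ≤ |x (s (j + 1)) - x t| ^ p :=
      Real.rpow_le_rpow (abs_nonneg _)
        (by
          rw [abs_sub_eq_of_neg_one_pow_mul_le hle, abs_sub_eq_of_neg_one_pow_mul_le ht1]
          linarith) hp0
    have := Finset.sum_nonneg (s := Finset.Ico (j + 1) k) fun i _ => hterm i
    linarith
  have hle' : (-1) ^ (j + 1) * x t ≤ (-1) ^ (j + 1) * x u := by
    rw [pow_succ]
    linarith
  have ht1' : (-1) ^ (j + 1) * x (s (j + 1)) ≤ (-1) ^ (j + 1) * x t := by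
    rw [pow_succ]
    linarith
  have hstart : 0 ≤ |x (s (j + 1)) - x t| ^ p := Real.rpow_nonneg (abs_nonneg _) p
  rcases (Nat.succ_le_of_lt hlt).eq_or_lt with heq | hlt2
  · obtain rfl : j + 1 = k := heq
    have := rpow_add_rpow_le_of_add_le (c := |x (s (j + 1 + 1)) - x (s (j + 1))|) hp
      (abs_nonneg (x u - x t)) (abs_nonneg (x (s (j + 1 + 1)) - x u))
      (by
        rw [abs_sub_eq_of_neg_one_pow_mul_le hle', abs_sub_eq_of_neg_one_pow_mul_le hu1,
          abs_sub_eq_of_neg_one_pow_mul_le (hu0.trans hu1)]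
        linarith)
    simp only [Finset.Ico_self, Finset.sum_empty] at hsplit
    linarith
  · have hlow : (-1) ^ (j + 1) * x u ≤ (-1) ^ (j + 1) * x (s (j + 1 + 1)) :=
      hdom (j + 1) (by omega) u ⟨(le_of_forall_lt_succ hincr hlt2 hk.le).trans hu.1, hu_one⟩
    have hfirst : |x u - x t| ^ p ≤ |x (s (j + 1 + 1)) - x (s (j + 1))| ^ p :=
      Real.rpow_le_rpow (abs_nonneg _)
        (by
          rw [abs_sub_eq_of_neg_one_pow_mul_le hle',
            abs_sub_eq_of_neg_one_pow_mul_le ((ht1'.trans hle').trans hlow)]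
          linarith) hp0
    have := Finset.single_le_sum (s := Finset.Ico (j + 1) k) (fun i _ => hterm i)
      (Finset.mem_Ico.2 ⟨le_rfl, hlt2⟩)
    linarith

/-- For a jog-free piecewise monotone continuous path `x` on `[0,1]` with `x 0 = 0`
and extrema `0 = s₀ < s₁ < ⋯ < s_n = 1`, the `p`-variation of `x` equals the sum
`Σ_{j=1}^n |x(s_j) − x(s_{j−1})|^p`. -/
theorem jog_free_p_variation
    (p : ℝ) (hp : 1 ≤ p)
    (x : ℝ → ℝ) (hx : ContinuousOn x (Icc 0 1)) (hx0 : x 0 = 0)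
    (n : ℕ) (s : ℕ → ℝ)
    (hs0 : s 0 = 0) (hsn : s n = 1)
    (hincr : ∀ i < n, s i < s (i + 1))
    (hup : ∀ j < n, Even j → MonotoneOn x (Icc (s j) (s (j + 1))))
    (hdown : ∀ j < n, Odd j → AntitoneOn x (Icc (s j) (s (j + 1))))
    (hmax : ∀ j, 1 ≤ j → j ≤ n → Odd j → x (s j) = sSup (x '' Icc (s j) 1))
    (hmin : ∀ j, 2 ≤ j → j ≤ n → Even j → x (s j) = sInf (x '' Icc (s j) 1)) :
    IsLUB (varSums p x) (∑ j ∈ Finset.range n, |x (s (j + 1)) - x (s j)| ^ p) := by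
  have hmono : ∀ j < n, MonotoneOn (fun t => (-1) ^ j * x t) (Icc (s j) (s (j + 1))) := by
    intro j hj a ha b hb hab
    rcases Nat.even_or_odd j with h | h
    · simpa [h.neg_one_pow] using hup j hj h ha hb hab
    · simpa [h.neg_one_pow] using hdown j hj h ha hb hab
  have hdom : ∀ j < n, ∀ t ∈ Icc (s (j + 1)) 1,
      (-1) ^ j * x t ≤ (-1) ^ j * x (s (j + 1)) := by
    intro j hj t ht
    have hpos : 0 ≤ s (j + 1) := hs0 ▸ le_of_forall_lt_succ hincr (Nat.zero_le _) hj
    have hcomp : IsCompact (x '' Icc (s (j + 1)) 1) :=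
      isCompact_Icc.image_of_continuousOn (hx.mono (Icc_subset_Icc_left hpos))
    rcases Nat.even_or_odd j with h | h
    · rw [h.neg_one_pow, one_mul, one_mul, hmax (j + 1) (by omega) hj h.add_one]
      exact le_csSup hcomp.bddAbove (mem_image_of_mem x ht)
    · have := h.pos
      rw [h.neg_one_pow, neg_one_mul, neg_one_mul, neg_le_neg_iff,
        hmin (j + 1) (by omega) hj h.add_one]
      exact csInf_le hcomp.bddBelow (mem_image_of_mem x ht)
  have hn : 0 < n := by
    rcases Nat.eq_zero_or_pos n with rfl | h
    · linarith
    · exact h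
  refine IsGreatest.isLUB ⟨⟨n, s, hs0, hsn, hincr, by simp only [Real.norm_eq_abs]⟩, ?_⟩
  rintro _ ⟨N, t, ht0, htN, htincr, rfl⟩
  have key : ∀ m ≤ N, ∃ k < n, t m ∈ Icc (s k) (s (k + 1)) ∧
      ∑ i ∈ Finset.range m, ‖x (t (i + 1)) - x (t i)‖ ^ p + tailVariation p x s n k (t m) ≤
        ∑ j ∈ Finset.range n, |x (s (j + 1)) - x (s j)| ^ p := by
    intro m
    induction m with
    | zero =>
      intro _
      refine ⟨0, hn, ?_, ?_⟩
      · rw [ht0, ← hs0]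
        exact ⟨le_rfl, (hincr 0 hn).le⟩
      · rw [Finset.range_eq_Ico, Finset.range_eq_Ico, Finset.sum_eq_sum_Ico_succ_bot hn]
        simp [tailVariation, ht0, hs0]
    | succ m ih =>
      intro hm
      obtain ⟨j, hj, htj, hsum⟩ := ih (by omega)
      have hlt := htincr m hm
      have hone : t (m + 1) ≤ s n := by
        rw [hsn, ← htN]
        exact le_of_forall_lt_succ htincr hm le_rfl
      have hex : ∃ k, k < n ∧ t (m + 1) ≤ s (k + 1) :=
        ⟨n - 1, by omega, by rwa [Nat.sub_add_cancel hn]⟩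
      classical
      obtain ⟨hk, hku⟩ := Nat.find_spec hex
      have hmin' := fun i => Nat.find_min (m := i) hex
      set k := Nat.find hex
      have hjk : j ≤ k := by
        by_contra! h
        linarith [le_of_forall_lt_succ hincr (Nat.succ_le_of_lt h) hj.le, htj.1]
      have hkl : s k ≤ t (m + 1) := by
        rcases hjk.eq_or_lt with h | h
        · rw [← h]
          exact htj.1.trans hlt.le
        · by_contra! hlt'
          refine hmin' (k - 1) (by omega) ⟨by omega, ?_⟩
          rw [Nat.sub_add_cancel (by omega)]
          exact hlt'.le
      refine ⟨k, hk, ⟨hkl, hku⟩, ?_⟩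
      have := rpow_add_tailVariation_le hp hsn hincr hmono hdom hjk hk htj ⟨hkl, hku⟩ hlt.le
      rw [Finset.sum_range_succ, Real.norm_eq_abs (x (t (m + 1)) - x (t m))]
      linarith
  obtain ⟨k, -, -, hle⟩ := key N le_rfl
  have : 0 ≤ tailVariation p x s n k (t N) :=
    add_nonneg (Real.rpow_nonneg (abs_nonneg _) p)
      (Finset.sum_nonneg fun i _ => Real.rpow_nonneg (abs_nonneg _) p)
  linarith
end

section
/- For every integer n ≥ 1 and every real p ≥ 1, the function c_n : [0,1] → ℝ defined by c_n(t) = cos(nπt) − 1 satisfies: the supremum over all finite partitions 0 = t_0 < t_1 < ⋯ < t_N = 1 of [0,1] of Σ_{i=1}^N |c_n(t_i) − c_n(t_{i−1})|^p equals n · 2^p; equivalently, the p-variation norm of c_n is 2 n^{1/p}. -/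
open Set Finset

theorem integral_abs_sin_nat_mul_pi (n : ℕ) :
    ∫ x in (0 : ℝ)..(n : ℝ) * Real.pi, |Real.sin x| = 2 * n := by
  have hper : Function.Periodic (fun x => |Real.sin x|) Real.pi := fun x => by
    simp [Real.sin_add_pi]
  have hpi : ∫ x in (0 : ℝ)..Real.pi, |Real.sin x| = 2 := by
    rw [intervalIntegral.integral_congr (g := Real.sin)]
    · rw [integral_sin]; norm_num
    · intro x hx
      rw [Set.uIcc_of_le Real.pi_pos.le] at hx
      exact abs_of_nonneg (Real.sin_nonneg_of_mem_Icc hx)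
  have hcont : Continuous fun x => |Real.sin x| := by fun_prop
  have h := hper.intervalIntegral_add_zsmul_eq n 0 (fun _ _ => hcont.intervalIntegrable _ _)
  simp only [zero_add, zsmul_eq_mul, Int.cast_natCast, hpi] at h
  rw [h, mul_comm]

theorem abs_cos_sub_cos_le_integral {a b : ℝ} (hab : a ≤ b) :
    |Real.cos b - Real.cos a| ≤ ∫ x in a..b, |Real.sin x| := by
  rw [abs_sub_comm, ← integral_sin]
  exact intervalIntegral.abs_integral_le_integral_abs hab

theorem rpow_le_two_rpow_mul_half {p x : ℝ} (hp : 1 ≤ p) (hx : 0 ≤ x) (hx2 : x ≤ 2) :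
    x ^ p ≤ 2 ^ p * (x / 2) := by
  have h : (x / 2) ^ p ≤ (x / 2) ^ (1 : ℝ) :=
    Real.rpow_le_rpow_of_exponent_ge' (by positivity) (by linarith) zero_le_one hp
  rw [Real.rpow_one, Real.div_rpow hx zero_le_two, div_le_iff₀ (by positivity)] at h
  linarith

theorem abs_cos_sub_cos_le_two (a b : ℝ) : |Real.cos a - Real.cos b| ≤ 2 := by
  rw [abs_le]
  constructor <;> linarith [Real.cos_le_one a, Real.cos_le_one b, Real.neg_one_le_cos a,
    Real.neg_one_le_cos b]

theorem abs_cos_succ_mul_pi_sub (i : ℕ) :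
    |Real.cos (((i + 1 : ℕ) : ℝ) * Real.pi) - Real.cos ((i : ℝ) * Real.pi)| = 2 := by
  rw [Real.cos_nat_mul_pi, Real.cos_nat_mul_pi, pow_succ,
    show (-1 : ℝ) ^ i * -1 - (-1) ^ i = (-1) ^ i * (-2) by ring, abs_mul, abs_pow]
  norm_num

/-- For `n ≥ 1` and `p ≥ 1`, the supremum of the `p`-variation sums of
`c_n(t) = cos(nπt) − 1` over all finite partitions of `[0,1]` equals `n · 2^p`;
equivalently, the `p`-variation norm of `c_n` is `2 n^{1/p}`. -/
theorem cos_p_variation (n : ℕ) (hn : 1 ≤ n) (p : ℝ) (hp : 1 ≤ p) :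
    IsLUB (varSums p (fun t => Real.cos ((n : ℝ) * Real.pi * t) - 1)) ((n : ℝ) * 2 ^ p) := by
  have hn0 : (0 : ℝ) < n := by exact_mod_cast hn
  refine IsGreatest.isLUB ⟨⟨n, fun i => (i : ℝ) / n, by simp, div_self hn0.ne', ?_, ?_⟩, ?_⟩
  · intro i _
    push_cast
    gcongr
    linarith
  · have h (i : ℕ) : (n : ℝ) * Real.pi * ((i : ℝ) / n) = i * Real.pi := by field_simp
    simp only [h, sub_sub_sub_cancel_right, Real.norm_eq_abs, abs_cos_succ_mul_pi_sub,
      Finset.sum_const, Finset.card_range, nsmul_eq_mul]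
  · rintro S ⟨N, t, h0, h1, ht, rfl⟩
    simp only [sub_sub_sub_cancel_right, Real.norm_eq_abs]
    have hcont : Continuous fun x => |Real.sin x| := by fun_prop
    calc ∑ i ∈ Finset.range N,
          |Real.cos (n * Real.pi * t (i + 1)) - Real.cos (n * Real.pi * t i)| ^ p
        ≤ ∑ i ∈ Finset.range N,
          2 ^ p * ((∫ x in (n * Real.pi * t i)..(n * Real.pi * t (i + 1)), |Real.sin x|) / 2) := by
          refine Finset.sum_le_sum fun i hi => ?_
          refine (rpow_le_two_rpow_mul_half hp (abs_nonneg _)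
            (abs_cos_sub_cos_le_two _ _)).trans ?_
          gcongr
          have hle := (ht i (Finset.mem_range.1 hi)).le
          exact abs_cos_sub_cos_le_integral (by gcongr)
      _ = n * 2 ^ p := by
          rw [← Finset.mul_sum, ← Finset.sum_div,
            intervalIntegral.sum_integral_adjacent_intervals
              (a := fun i => n * Real.pi * t i) (fun _ _ => hcont.intervalIntegrable _ _),
            h0, h1, mul_zero, mul_one, integral_abs_sin_nat_mul_pi]
          ring
end

section
/- Let p ≥ 1 and δ ∈ (0,1) with α := δ − 1/p > 0. There exists a constant C, depending only on p and δ, such that for every continuous function f : [0,1] → ℝ^d and all 0 ≤ s ≤ t ≤ 1, |f(t) − f(s)|^p ≤ C · (t − s)^{αp} · B_{δ,p}(f; s, t), where B_{δ,p}(f; s, t) = ∫_s^t ∫_s^t |f(u) − f(v)|^p / |u − v|^{1+δp} du dv (the inequality being trivially true when the double integral is infinite). -/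
open Set MeasureTheory
open scoped ENNReal

/-- The Besov-type double integral
`B_{δ,p}(f; s, t) = ∫_s^t ∫_s^t ‖f u − f v‖^p / |u − v|^(1+δp) du dv`,
valued in `ℝ≥0∞` so that it may be infinite. -/
noncomputable def besov (p δ : ℝ) {d : ℕ} (f : ℝ → EuclideanSpace ℝ (Fin d)) (s t : ℝ) : ℝ≥0∞ :=
  ∫⁻ u in Icc s t, ∫⁻ v in Icc s t,
    ENNReal.ofReal (‖f u - f v‖ ^ p / |u - v| ^ (1 + δ * p))

section JensenAverage

variable {E : Type*} [NormedAddCommGroup E] [NormedSpace ℝ E]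

lemma ofReal_norm_setAverage_sub_rpow_le [CompleteSpace E] {p a b : ℝ} (hp : 1 ≤ p) (hab : a < b)
    {f : ℝ → E} (hf : ContinuousOn f (Icc a b)) (c : E) :
    ENNReal.ofReal (‖(⨍ x in Icc a b, f x) - c‖ ^ p) ≤
      ENNReal.ofReal (b - a)⁻¹ * ∫⁻ x in Icc a b, ENNReal.ofReal (‖f x - c‖ ^ p) := by
  have hp0 : 0 ≤ p := by linarith
  have hconv : ConvexOn ℝ univ fun z : E => ‖z - c‖ ^ p := by
    have hd : ConvexOn ℝ univ fun z : E => ‖z - c‖ := by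
      simpa only [dist_eq_norm] using convexOn_dist c (convex_univ (𝕜 := ℝ) (E := E))
    refine ⟨convex_univ, fun x _ y _ u v hu hv huv => ?_⟩
    calc ‖u • x + v • y - c‖ ^ p ≤ (u • ‖x - c‖ + v • ‖y - c‖) ^ p := by
          exact Real.rpow_le_rpow (norm_nonneg _)
            (hd.2 (mem_univ x) (mem_univ y) hu hv huv) hp0
      _ ≤ _ := (convexOn_rpow hp).2 (norm_nonneg _) (norm_nonneg _) hu hv huv
  have hcont : Continuous fun z : E => ‖z - c‖ ^ p :=
    (continuous_id.sub continuous_const).norm.rpow_const fun _ => Or.inr hp0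
  have hint : IntegrableOn (fun x => ‖f x - c‖ ^ p) (Icc a b) :=
    (hcont.comp_continuousOn hf).integrableOn_compact isCompact_Icc
  have hjensen : ‖(⨍ x in Icc a b, f x) - c‖ ^ p ≤ ⨍ x in Icc a b, ‖f x - c‖ ^ p :=
    hconv.map_set_average_le hcont.continuousOn isClosed_univ (by simp [hab]) (by simp)
      (by simp) (hf.integrableOn_compact isCompact_Icc) hint
  refine (ENNReal.ofReal_le_ofReal hjensen).trans_eq ?_
  rw [setAverage_eq, smul_eq_mul, Real.volume_real_Icc_of_le hab.le,
    ENNReal.ofReal_mul (by simpa using hab.le), ofReal_integral_eq_lintegral_ofReal hint]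
  exact Filter.Eventually.of_forall fun x => by positivity

lemma tendsto_setAverage_Icc_of_continuousOn [CompleteSpace E] {f : ℝ → E} {S : Set ℝ} {x : ℝ}
    (hx : ContinuousWithinAt f S x) (hf : ContinuousOn f S) {a b : ℕ → ℝ} (hab : ∀ n, a n < b n)
    (hxab : ∀ n, x ∈ Icc (a n) (b n)) (hS : ∀ n, Icc (a n) (b n) ⊆ S)
    (hlim : Filter.Tendsto (fun n => b n - a n) Filter.atTop (nhds 0)) :
    Filter.Tendsto (fun n => ⨍ y in Icc (a n) (b n), f y) Filter.atTop (nhds (f x)) := by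
  rw [Metric.tendsto_atTop']
  intro ε hε
  obtain ⟨η, hη, H⟩ := Metric.continuousWithinAt_iff.1 hx (ε / 2) (by positivity)
  obtain ⟨N, hN⟩ := Filter.eventually_atTop.1 (hlim.eventually (gt_mem_nhds hη))
  refine ⟨N, fun n hn => ?_⟩
  have hmem : (⨍ y in Icc (a n) (b n), f y) ∈ Metric.closedBall (f x) (ε / 2) := by
    refine (convex_closedBall (f x) (ε / 2)).set_average_mem Metric.isClosed_closedBall
      (by simp [hab n]) (by simp) ?_ ((hf.mono (hS n)).integrableOn_compact isCompact_Icc)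
    refine (ae_restrict_iff' measurableSet_Icc).2 (Filter.Eventually.of_forall fun y hy => ?_)
    refine (H (hS n hy) ?_).le
    have h1 := hN n hn.le
    have h2 := hxab n
    rw [Real.dist_eq, abs_lt]
    constructor <;> linarith [hy.1, hy.2, h2.1, h2.2]
  exact (Metric.mem_closedBall.1 hmem).trans_lt (by linarith)

end JensenAverage

lemma besov_mono {p δ : ℝ} {d : ℕ} (f : ℝ → EuclideanSpace ℝ (Fin d)) {s t c e : ℝ}
    (h : Icc c e ⊆ Icc s t) : besov p δ f c e ≤ besov p δ f s t :=
  (lintegral_mono_set h).trans (lintegral_mono fun _ => lintegral_mono_set h)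

lemma ofReal_norm_setAverage_sub_setAverage_rpow_le {p δ : ℝ} (hp : 1 ≤ p) (hδ : 0 < δ) {d : ℕ}
    {f : ℝ → EuclideanSpace ℝ (Fin d)} {a b a' b' c e : ℝ} (hf : ContinuousOn f (Icc c e))
    (hab : a < b) (hab' : a' < b') (hI : Icc a b ⊆ Icc c e) (hJ : Icc a' b' ⊆ Icc c e) :
    ENNReal.ofReal (‖(⨍ x in Icc a b, f x) - ⨍ x in Icc a' b', f x‖ ^ p) ≤
      ENNReal.ofReal ((b - a)⁻¹ * (b' - a')⁻¹ * (e - c) ^ (1 + δ * p)) * besov p δ f c e := by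
  have hexp : 0 < 1 + δ * p := by positivity
  have hba : 0 ≤ (b - a)⁻¹ := inv_nonneg.2 (by linarith)
  have hba' : 0 ≤ (b' - a')⁻¹ := inv_nonneg.2 (by linarith)
  have hpt : ∀ u ∈ Icc c e, ∀ v ∈ Icc c e, ENNReal.ofReal (‖f u - f v‖ ^ p) ≤
      ENNReal.ofReal ((e - c) ^ (1 + δ * p)) *
        ENNReal.ofReal (‖f u - f v‖ ^ p / |u - v| ^ (1 + δ * p)) := by
    intro u hu v hv
    have hce : 0 ≤ e - c := by linarith [hu.1, hu.2]
    rw [← ENNReal.ofReal_mul (by positivity)]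
    refine ENNReal.ofReal_le_ofReal ?_
    rcases eq_or_ne u v with rfl | huv
    · simp [Real.zero_rpow (by linarith : p ≠ 0), Real.zero_rpow hexp.ne']
    · have hpos : 0 < |u - v| := abs_pos.2 (sub_ne_zero.2 huv)
      have hle : |u - v| ≤ e - c := by
        rw [abs_le]; constructor <;> linarith [hu.1, hu.2, hv.1, hv.2]
      have hpos' : 0 < |u - v| ^ (1 + δ * p) := Real.rpow_pos_of_pos hpos _
      rw [mul_div_assoc', le_div_iff₀ hpos', mul_comm]
      gcongr
  calc ENNReal.ofReal (‖(⨍ x in Icc a b, f x) - ⨍ x in Icc a' b', f x‖ ^ p)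
      ≤ ENNReal.ofReal (b - a)⁻¹ *
          ∫⁻ u in Icc a b, ENNReal.ofReal (‖f u - ⨍ x in Icc a' b', f x‖ ^ p) :=
        ofReal_norm_setAverage_sub_rpow_le hp hab (hf.mono hI) _
    _ ≤ ENNReal.ofReal (b - a)⁻¹ * ∫⁻ u in Icc a b, ENNReal.ofReal (b' - a')⁻¹ *
          (ENNReal.ofReal ((e - c) ^ (1 + δ * p)) * ∫⁻ v in Icc c e,
            ENNReal.ofReal (‖f u - f v‖ ^ p / |u - v| ^ (1 + δ * p))) := by
        gcongr ENNReal.ofReal (b - a)⁻¹ * ?_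
        refine setLIntegral_mono' measurableSet_Icc fun u hu => ?_
        rw [norm_sub_rev]
        refine (ofReal_norm_setAverage_sub_rpow_le hp hab' (hf.mono hJ) (f u)).trans ?_
        gcongr ENNReal.ofReal (b' - a')⁻¹ * ?_
        rw [← lintegral_const_mul' _ _ ENNReal.ofReal_ne_top]
        refine le_trans ?_ (lintegral_mono_set hJ)
        refine setLIntegral_mono' measurableSet_Icc fun v hv => ?_
        rw [norm_sub_rev]
        exact hpt u (hI hu) v (hJ hv)
    _ = ENNReal.ofReal ((b - a)⁻¹ * (b' - a')⁻¹ * (e - c) ^ (1 + δ * p)) *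
          ∫⁻ u in Icc a b, ∫⁻ v in Icc c e,
            ENNReal.ofReal (‖f u - f v‖ ^ p / |u - v| ^ (1 + δ * p)) := by
        rw [lintegral_const_mul' _ _ ENNReal.ofReal_ne_top,
          lintegral_const_mul' _ _ ENNReal.ofReal_ne_top,
          ENNReal.ofReal_mul (by positivity), ENNReal.ofReal_mul hba]
        ring
    _ ≤ _ := by
        gcongr
        exact lintegral_mono_set hI

lemma norm_setAverage_sub_le_of_nested {p δ : ℝ} (hp : 1 ≤ p) (hδ : 0 < δ) (hα : 0 < δ - 1 / p)
    {d : ℕ} {f : ℝ → EuclideanSpace ℝ (Fin d)} {s t x : ℝ} (hst : s < t)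
    (hf : ContinuousOn f (Icc s t)) (hB : besov p δ f s t ≠ ∞) {a b : ℕ → ℝ}
    (ha0 : a 0 = s) (hb0 : b 0 = t) (ha : Monotone a) (hb : Antitone b)
    (hlen : ∀ n, b n - a n = (t - s) * (1 / 2) ^ n) (hx : ∀ n, x ∈ Icc (a n) (b n)) :
    ‖(⨍ y in Icc s t, f y) - f x‖ ≤
      (2 * (besov p δ f s t).toReal) ^ (1 / p) * (t - s) ^ (δ - 1 / p) /
        (1 - (1 / 2) ^ (δ - 1 / p)) := by
  have hp0 : 0 < p := by linarith
  have hh : 0 < t - s := sub_pos.2 hst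
  set B := (besov p δ f s t).toReal
  have hB0 : 0 ≤ B := ENNReal.toReal_nonneg
  have hpos : ∀ n, 0 < b n - a n := fun n => by rw [hlen]; positivity
  have hsub : ∀ n, Icc (a n) (b n) ⊆ Icc s t := fun n =>
    Icc_subset_Icc (ha0 ▸ ha n.zero_le) (hb0 ▸ hb n.zero_le)
  have hstep : ∀ n, dist (⨍ y in Icc (a n) (b n), f y) (⨍ y in Icc (a (n + 1)) (b (n + 1)), f y) ≤
      (2 * B) ^ (1 / p) * (t - s) ^ (δ - 1 / p) * ((1 / 2 : ℝ) ^ (δ - 1 / p)) ^ n := by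
    intro n
    have hnest : Icc (a (n + 1)) (b (n + 1)) ⊆ Icc (a n) (b n) :=
      Icc_subset_Icc (ha n.le_succ) (hb n.le_succ)
    have key := (ofReal_norm_setAverage_sub_setAverage_rpow_le hp hδ (hf.mono (hsub n))
      (sub_pos.1 (hpos n)) (sub_pos.1 (hpos (n + 1))) subset_rfl hnest).trans
        (mul_le_mul_right (besov_mono f (hsub n)) _)
    have hn := (hpos n).le
    have hhalf : b (n + 1) - a (n + 1) = (b n - a n) / 2 := by
      rw [hlen, hlen, pow_succ]; ring
    rw [← ENNReal.ofReal_toReal hB, ← ENNReal.ofReal_mul' ENNReal.toReal_nonneg,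
      ENNReal.ofReal_le_ofReal_iff
        (mul_nonneg (mul_nonneg (mul_nonneg (inv_nonneg.2 hn) (inv_nonneg.2 (hpos (n + 1)).le))
          (Real.rpow_nonneg hn _)) hB0), hhalf] at key
    have hscale : (b n - a n)⁻¹ * ((b n - a n) / 2)⁻¹ * (b n - a n) ^ (1 + δ * p) * B =
        2 * B * ((b n - a n) ^ (δ - 1 / p)) ^ p := by
      have hn := hpos n
      rw [← Real.rpow_mul hn.le, show 1 + δ * p = (δ - 1 / p) * p + 1 + 1 by field_simp; ring,
        Real.rpow_add_one hn.ne', Real.rpow_add_one hn.ne']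
      field_simp
    rw [hscale] at key
    have hroot := Real.rpow_le_rpow (by positivity) key (by positivity : 0 ≤ 1 / p)
    rw [Real.mul_rpow (by positivity) (by positivity), ← Real.rpow_mul (norm_nonneg _),
      ← Real.rpow_mul (by positivity), mul_one_div_cancel hp0.ne', Real.rpow_one, Real.rpow_one,
      hlen, Real.mul_rpow hh.le (by positivity), ← Real.rpow_natCast, ← Real.rpow_mul (by norm_num),
      mul_comm (n : ℝ), Real.rpow_mul (by norm_num), Real.rpow_natCast, ← mul_assoc] at hroot
    rwa [dist_eq_norm]
  have hlim : Filter.Tendsto (fun n => b n - a n) Filter.atTop (nhds 0) := by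
    simp_rw [hlen]
    simpa using (tendsto_pow_atTop_nhds_zero_of_lt_one (by norm_num : (0 : ℝ) ≤ 1 / 2)
      (by norm_num)).const_mul (t - s)
  have hconv := tendsto_setAverage_Icc_of_continuousOn (hf x (hsub 0 (hx 0))) hf
    (fun n => sub_pos.1 (hpos n)) hx hsub hlim
  have := dist_le_of_le_geometric_of_tendsto₀ _ _
    (Real.rpow_lt_one (by norm_num) (by norm_num) hα) hstep hconv
  rwa [dist_eq_norm, ha0, hb0] at this

/-- Garsia–Rodemich–Rumsey-type estimate: for `p ≥ 1`, `δ ∈ (0,1)` with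
`α = δ − 1/p > 0`, there is a constant `C = C(p, δ)` such that for every continuous
`f : [0,1] → ℝ^d` and all `0 ≤ s ≤ t ≤ 1`,
`‖f t − f s‖^p ≤ C (t − s)^{αp} B_{δ,p}(f; s, t)`. -/
theorem besov_pointwise_holder (p δ : ℝ) (hp : 1 ≤ p) (hδ : δ ∈ Ioo (0 : ℝ) 1)
    (hα : 0 < δ - 1 / p) :
    ∃ C : ℝ, ∀ (d : ℕ) (f : ℝ → EuclideanSpace ℝ (Fin d)),
      ContinuousOn f (Icc 0 1) → ∀ s t : ℝ, 0 ≤ s → s ≤ t → t ≤ 1 →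
      ENNReal.ofReal (‖f t - f s‖ ^ p) ≤
        ENNReal.ofReal (C * (t - s) ^ ((δ - 1 / p) * p)) * besov p δ f s t := by
  have hp0 : 0 < p := by linarith
  have hr : (1 / 2 : ℝ) ^ (δ - 1 / p) < 1 := Real.rpow_lt_one (by norm_num) (by norm_num) hα
  have hr' : 0 < 1 - (1 / 2 : ℝ) ^ (δ - 1 / p) := sub_pos.2 hr
  refine ⟨(2 / (1 - (1 / 2 : ℝ) ^ (δ - 1 / p))) ^ p * 2, fun d f hf s t hs hst ht => ?_⟩
  rcases hst.eq_or_lt with rfl | hlt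
  · simp [Real.zero_rpow hp0.ne']
  have hh : 0 < t - s := sub_pos.2 hlt
  have hC : 0 < (2 / (1 - (1 / 2 : ℝ) ^ (δ - 1 / p))) ^ p * 2 * (t - s) ^ ((δ - 1 / p) * p) := by
    positivity
  by_cases hB : besov p δ f s t = ∞
  · rw [hB, ENNReal.mul_top (ENNReal.ofReal_pos.2 hC).ne']
    exact le_top
  have hf' : ContinuousOn f (Icc s t) := hf.mono (Icc_subset_Icc hs ht)
  have hanti : Antitone fun n : ℕ => (t - s) * (1 / 2 : ℝ) ^ n := fun m n hmn =>
    mul_le_mul_of_nonneg_left (pow_le_pow_of_le_one (by norm_num) (by norm_num) hmn) hh.le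
  have hn0 : ∀ n : ℕ, 0 ≤ (t - s) * (1 / 2 : ℝ) ^ n := fun n => by positivity
  have hright := norm_setAverage_sub_le_of_nested (x := t) hp hδ.1 hα hlt hf' hB
    (a := fun n => t - (t - s) * (1 / 2) ^ n) (b := fun _ => t) (by simp) rfl
    (fun m n hmn => sub_le_sub_left (hanti hmn) t) antitone_const (fun n => by ring)
    (fun n => ⟨by linarith [hn0 n], le_rfl⟩)
  have hleft := norm_setAverage_sub_le_of_nested (x := s) hp hδ.1 hα hlt hf' hB
    (a := fun _ => s) (b := fun n => s + (t - s) * (1 / 2) ^ n) rfl (by simp) monotone_const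
    (fun m n hmn => add_le_add_right (hanti hmn) s) (fun n => by ring)
    (fun n => ⟨le_rfl, by linarith [hn0 n]⟩)
  have hB0 : 0 ≤ (besov p δ f s t).toReal := ENNReal.toReal_nonneg
  have hnorm : ‖f t - f s‖ ≤ 2 / (1 - (1 / 2 : ℝ) ^ (δ - 1 / p)) *
      (2 * (besov p δ f s t).toReal) ^ (1 / p) * (t - s) ^ (δ - 1 / p) := by
    rw [norm_sub_rev] at hright
    refine (norm_sub_le_norm_sub_add_norm_sub _ (⨍ y in Icc s t, f y) _).trans
      ((add_le_add hright hleft).trans_eq ?_)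
    ring
  have hpow := Real.rpow_le_rpow (norm_nonneg _) hnorm hp0.le
  rw [Real.mul_rpow (by positivity) (by positivity), Real.mul_rpow (by positivity) (by positivity),
    ← Real.rpow_mul (by positivity : 0 ≤ 2 * (besov p δ f s t).toReal),
    one_div_mul_cancel hp0.ne', Real.rpow_one, ← Real.rpow_mul hh.le] at hpow
  rw [← ENNReal.ofReal_toReal hB, ← ENNReal.ofReal_mul hC.le]
  refine ENNReal.ofReal_le_ofReal (hpow.trans_eq ?_)
  ring
end

section
/- Let p > 1, γ > p − 1, and let K ≥ 2 be an integer. Let (η_i)_{i≥1} be a sequence of integers with 2 ≤ η_i ≤ K for all i; set M_n = η_1 η_2 ⋯ η_n and t^n_l = l / M_n for 0 ≤ l ≤ M_n. Then there exists a constant c, depending only on K, p and γ (and not on the particular sequence (η_i)), such that for every continuous function x : [0,1] → ℝ^d: the supremum over all finite partitions 0 = t_0 < t_1 < ⋯ < t_N = 1 of Σ_{i=1}^N |x(t_i) − x(t_{i−1})|^p is at most c · Σ_{n=1}^∞ n^γ Σ_{l=1}^{M_n} |x(t^n_l) − x(t^n_{l−1})|^p (the inequality being trivially true when the right-hand side is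 infinite). -/
open Set Finset
open scoped ENNReal

open Filter Topology

/-- Increments of a sequence over a window of length at most `m`, by the power mean inequality. -/
lemma norm_sub_rpow_le {E : Type*} [NormedAddCommGroup E] {p : ℝ} (hp : 1 ≤ p) (y : ℕ → E)
    {a b m : ℕ} (hab : a ≤ b) (hm : b - a ≤ m) :
    ‖y b - y a‖ ^ p ≤ (m : ℝ) ^ (p - 1) *
      (∑ l ∈ Finset.range b, ‖y (l + 1) - y l‖ ^ p - ∑ l ∈ Finset.range a, ‖y (l + 1) - y l‖ ^ p) := by
  rw [← Finset.sum_Ico_eq_sub _ hab, ← Finset.sum_Ico_sub y hab]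
  have h := Real.rpow_sum_le_const_mul_sum_rpow_of_nonneg (Finset.Ico a b) (f := fun l => ‖y (l + 1) - y l‖)
    hp (fun _ _ => norm_nonneg _)
  calc ‖∑ l ∈ Finset.Ico a b, (y (l + 1) - y l)‖ ^ p
      ≤ (∑ l ∈ Finset.Ico a b, ‖y (l + 1) - y l‖) ^ p := by
        gcongr
        exact norm_sum_le _ _
    _ ≤ _ := h
    _ ≤ _ := by
        rw [Nat.card_Ico]
        have : ((b - a : ℕ) : ℝ) ≤ m := by exact_mod_cast hm
        gcongr

lemma norm_sub_rpow_le_two {E : Type*} [NormedAddCommGroup E] {p : ℝ} (hp : 1 ≤ p) (u v : E) :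
    ‖u - v‖ ^ p ≤ 2 ^ (p - 1) * (‖u‖ ^ p + ‖v‖ ^ p) := by
  calc ‖u - v‖ ^ p ≤ (‖u‖ + ‖v‖) ^ p := by
        gcongr
        exact norm_sub_le u v
    _ ≤ _ := by exact_mod_cast NNReal.rpow_add_le_mul_rpow_add_rpow ‖u‖₊ ‖v‖₊ hp

/-- The difference of the increments of `y` from the starts of the blocks of length `q` containing
`a` and `b`, controlled by a telescoping quantity. -/
lemma norm_block_sub_rpow_le {E : Type*} [NormedAddCommGroup E] {p : ℝ} (hp : 1 ≤ p) (y : ℕ → E)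
    {q K : ℕ} (hq : 0 < q) (hqK : q ≤ K) {a b : ℕ} (hab : a ≤ b) :
    ‖(y b - y (q * (b / q))) - (y a - y (q * (a / q)))‖ ^ p ≤
      2 ^ (p - 1) * (K : ℝ) ^ (p - 1) *
        ((∑ l ∈ Finset.range b, ‖y (l + 1) - y l‖ ^ p - ∑ l ∈ Finset.range a, ‖y (l + 1) - y l‖ ^ p) +
          (∑ l ∈ Finset.range (q * (b / q)), ‖y (l + 1) - y l‖ ^ p -
            ∑ l ∈ Finset.range (q * (a / q)), ‖y (l + 1) - y l‖ ^ p)) := by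
  set W : ℕ → ℝ := fun n => ∑ l ∈ Finset.range n, ‖y (l + 1) - y l‖ ^ p
  have hmono : Monotone W := fun m n hmn =>
    Finset.sum_le_sum_of_subset_of_nonneg (Finset.range_mono hmn) (fun _ _ _ => by positivity)
  have hdiv : a / q ≤ b / q := Nat.div_le_div_right hab
  have h2 : (1 : ℝ) ≤ 2 ^ (p - 1) := Real.one_le_rpow (by norm_num) (by linarith)
  have hmod (n : ℕ) : q * (n / q) ≤ n ∧ n - q * (n / q) ≤ K ∧ n ≤ q * (n / q) + q := by
    have h1 := Nat.div_add_mod n q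
    have h3 := Nat.mod_lt n hq
    omega
  change _ ≤ 2 ^ (p - 1) * (K : ℝ) ^ (p - 1) * ((W b - W a) + (W (q * (b / q)) - W (q * (a / q))))
  rcases hdiv.eq_or_lt with h | h
  · have hba : b - a ≤ K := by
      have := hmod a
      have := hmod b
      rw [h] at *
      omega
    rw [h, sub_sub_sub_cancel_right, sub_self, add_zero]
    refine (norm_sub_rpow_le hp y hab hba).trans ?_
    have : 0 ≤ W b - W a := sub_nonneg.2 (hmono hab)
    rw [mul_assoc]
    exact le_mul_of_one_le_left (by positivity) h2
  · have hnext : q * (a / q) + q ≤ q * (b / q) := by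
      calc q * (a / q) + q = q * (a / q + 1) := by ring
        _ ≤ _ := Nat.mul_le_mul_left _ h
    have e1 := norm_sub_rpow_le hp y (hmod b).1 (hmod b).2.1
    have e2 := norm_sub_rpow_le hp y (hmod a).1 (hmod a).2.1
    refine (norm_sub_rpow_le_two hp _ _).trans ?_
    rw [mul_assoc]
    refine mul_le_mul_of_nonneg_left ((add_le_add e1 e2).trans ?_) (by positivity)
    rw [← mul_add]
    have h3 : W a ≤ W (q * (b / q)) := hmono ((hmod a).2.2.trans hnext)
    refine mul_le_mul_of_nonneg_left ?_ (by positivity)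
    change (W b - W (q * (b / q))) + (W a - W (q * (a / q))) ≤ _
    linarith

lemma sum_norm_block_sub_rpow_le {E : Type*} [NormedAddCommGroup E] {p : ℝ} (hp : 1 ≤ p)
    (y : ℕ → E) {q K : ℕ} (hq : 0 < q) (hqK : q ≤ K) {N M : ℕ} {a : ℕ → ℕ}
    (ha : ∀ i < N, a i ≤ a (i + 1)) (hM : a N ≤ M) :
    ∑ i ∈ Finset.range N, ‖(y (a (i + 1)) - y (q * (a (i + 1) / q))) -
        (y (a i) - y (q * (a i / q)))‖ ^ p ≤
      2 * (2 ^ (p - 1) * (K : ℝ) ^ (p - 1)) * ∑ l ∈ Finset.range M, ‖y (l + 1) - y l‖ ^ p := by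
  set W : ℕ → ℝ := fun n => ∑ l ∈ Finset.range n, ‖y (l + 1) - y l‖ ^ p
  have hmono : Monotone W := fun m n hmn =>
    Finset.sum_le_sum_of_subset_of_nonneg (Finset.range_mono hmn) (fun _ _ _ => by positivity)
  have hpos (n : ℕ) : 0 ≤ W n := Finset.sum_nonneg fun _ _ => by positivity
  refine (Finset.sum_le_sum fun i hi =>
    norm_block_sub_rpow_le hp y hq hqK (ha i (Finset.mem_range.1 hi))).trans ?_
  rw [← Finset.mul_sum, Finset.sum_add_distrib, Finset.sum_range_sub (fun i => W (a i)),
    Finset.sum_range_sub (fun i => W (q * (a i / q)))]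
  have h1 : W (a N) ≤ W M := hmono hM
  have h2 : W (q * (a N / q)) ≤ W M := hmono ((Nat.mul_div_le _ _).trans hM)
  have h3 := hpos (a 0)
  have h4 := hpos (q * (a 0 / q))
  have hC : 0 ≤ 2 ^ (p - 1) * (K : ℝ) ^ (p - 1) := by positivity
  rw [mul_comm (2 : ℝ) (2 ^ (p - 1) * (K : ℝ) ^ (p - 1)),
    mul_assoc (2 ^ (p - 1) * (K : ℝ) ^ (p - 1))]
  refine mul_le_mul_of_nonneg_left ?_ hC
  change _ ≤ 2 * W M
  linarith

/-- Weighted Hölder inequality with polynomial weights. -/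
lemma exists_sum_rpow_le_weighted {p γ : ℝ} (hp : 1 < p) (hγ : p - 1 < γ) :
    ∃ A : ℝ, 0 ≤ A ∧ ∀ (n : ℕ) (u : ℕ → ℝ), (∀ k, 0 ≤ u k) →
      (∑ k ∈ Finset.range n, u k) ^ p ≤ A * ∑ k ∈ Finset.range n, ((k : ℝ) + 1) ^ γ * u k ^ p := by
  have hp1 : 0 < p - 1 := by linarith
  set w : ℕ → ℝ := fun k => ((k : ℝ) + 1) ^ (-(γ / (p - 1))) with hw
  have hw0 (k : ℕ) : 0 < w k := Real.rpow_pos_of_pos (by positivity) _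
  have hsum : Summable w := by
    have hlt : -(γ / (p - 1)) < -1 := neg_lt_neg ((one_lt_div hp1).2 hγ)
    have h := (summable_nat_add_iff 1).2 (Real.summable_nat_rpow.2 hlt)
    simpa [hw] using h
  refine ⟨(∑' k, w k) ^ (p - 1), Real.rpow_nonneg (tsum_nonneg fun k => (hw0 k).le) _, ?_⟩
  intro n u hu
  have h := Real.inner_le_weight_mul_Lp_of_nonneg (Finset.range n) hp.le w (fun k => u k / w k)
    (fun k => (hw0 k).le) (fun k => div_nonneg (hu k) (hw0 k).le)
  have hsimp (k : ℕ) : w k * (u k / w k) = u k := mul_div_cancel₀ _ (hw0 k).ne'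
  have hsimp' (k : ℕ) : w k * (u k / w k) ^ p = ((k : ℝ) + 1) ^ γ * u k ^ p := by
    rw [Real.div_rpow (hu k) (hw0 k).le]
    have : ((k : ℝ) + 1) ^ γ = w k / w k ^ p := by
      have e : w k / w k ^ p = w k ^ (1 - p) := by
        rw [Real.rpow_sub (hw0 k), Real.rpow_one]
      rw [e, hw, ← Real.rpow_mul (by positivity)]
      congr 1
      field_simp
      ring
    rw [this]
    ring
  simp only [hsimp, hsimp'] at h
  have hW0 : 0 ≤ ∑ k ∈ Finset.range n, w k := Finset.sum_nonneg fun k _ => (hw0 k).le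
  have hU0 : 0 ≤ ∑ k ∈ Finset.range n, ((k : ℝ) + 1) ^ γ * u k ^ p :=
    Finset.sum_nonneg fun k _ => mul_nonneg (by positivity) (Real.rpow_nonneg (hu k) _)
  calc (∑ k ∈ Finset.range n, u k) ^ p
      ≤ ((∑ k ∈ Finset.range n, w k) ^ (1 - p⁻¹) *
          (∑ k ∈ Finset.range n, ((k : ℝ) + 1) ^ γ * u k ^ p) ^ p⁻¹) ^ p :=
        Real.rpow_le_rpow (Finset.sum_nonneg fun k _ => hu k) h (by linarith)
    _ = (∑ k ∈ Finset.range n, w k) ^ (p - 1) * ∑ k ∈ Finset.range n, ((k : ℝ) + 1) ^ γ * u k ^ p := by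
        rw [Real.mul_rpow (by positivity) (by positivity), ← Real.rpow_mul hW0,
          ← Real.rpow_mul hU0, inv_mul_cancel₀ (by linarith), Real.rpow_one]
        congr 2
        field_simp
    _ ≤ _ := by
        gcongr
        exact hsum.sum_le_tsum _ fun k _ => (hw0 k).le

/-- The index of the interval `[l / M, (l + 1) / M]` with `l < M` that contains `t ∈ [0,1]`. -/
noncomputable def cellIndex (M : ℕ) (t : ℝ) : ℕ := min ⌊t * M⌋₊ (M - 1)

lemma cellIndex_mono (M : ℕ) {s t : ℝ} (h : s ≤ t) : cellIndex M s ≤ cellIndex M t :=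
  min_le_min_right _ (Nat.floor_mono (by gcongr))

lemma cellIndex_mul_div (M : ℕ) {q : ℕ} (hM : 0 < M) (hq : 0 < q) (t : ℝ) :
    cellIndex (M * q) t / q = cellIndex M t := by
  have hmono : Monotone (fun n : ℕ => n / q) := fun _ _ h => Nat.div_le_div_right h
  have h1 : (M * q - 1) / q = M - 1 := by
    obtain ⟨m, rfl⟩ : ∃ m, M = m + 1 := ⟨M - 1, by omega⟩
    have : (m + 1) * q - 1 = (q - 1) + q * m := by
      rw [add_mul, mul_comm q m]; omega
    rw [this, Nat.add_mul_div_left _ _ hq, Nat.div_eq_of_lt (by omega)]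
    simp
  have h2 : ⌊t * ((M * q : ℕ) : ℝ)⌋₊ / q = ⌊t * M⌋₊ := by
    rw [← Nat.floor_div_natCast]
    congr 1
    push_cast
    field_simp
  unfold cellIndex
  exact (hmono.map_min).trans (by simp only [h1, h2])

lemma cellIndex_div_mem_Icc (M : ℕ) (t : ℝ) : (cellIndex M t : ℝ) / M ∈ Icc (0 : ℝ) 1 := by
  refine ⟨by positivity, div_le_one_of_le₀ ?_ (by positivity)⟩
  exact_mod_cast (min_le_right _ _).trans (Nat.sub_le _ _)

lemma abs_cellIndex_div_sub_le {M : ℕ} (hM : 0 < M) {t : ℝ} (ht : t ∈ Icc (0 : ℝ) 1) :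
    |(cellIndex M t : ℝ) / M - t| ≤ 1 / M := by
  have hM' : (0 : ℝ) < M := by exact_mod_cast hM
  have hfl : (⌊t * M⌋₊ : ℝ) ≤ t * M := Nat.floor_le (mul_nonneg ht.1 hM'.le)
  have hlt : t * M < ⌊t * M⌋₊ + 1 := Nat.lt_floor_add_one _
  have hle : t * M ≤ M := mul_le_of_le_one_left hM'.le ht.2
  have hub : (cellIndex M t : ℝ) ≤ t * M :=
    (Nat.cast_le.2 (min_le_left _ _)).trans hfl
  have hlb : t * M ≤ cellIndex M t + 1 := by
    unfold cellIndex
    rcases min_choice ⌊t * (M : ℝ)⌋₊ (M - 1) with h | h <;> rw [h]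
    · exact hlt.le
    · rw [Nat.cast_sub hM]
      simpa using hle
  have e : (cellIndex M t : ℝ) / M - t = (cellIndex M t - t * M) / M := by field_simp
  rw [e, abs_div, abs_of_pos hM']
  gcongr
  rw [abs_le]
  constructor <;> linarith

lemma tendsto_cellIndex_div {M : ℕ → ℕ} (hM : Tendsto M atTop atTop) {t : ℝ}
    (ht : t ∈ Icc (0 : ℝ) 1) :
    Tendsto (fun n => (cellIndex (M n) t : ℝ) / M n) atTop (𝓝 t) := by
  rw [tendsto_iff_dist_tendsto_zero]
  refine squeeze_zero' (.of_forall fun _ => dist_nonneg) ?_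
    ((tendsto_const_nhds (x := (1 : ℝ))).div_atTop (tendsto_natCast_atTop_atTop.comp hM))
  filter_upwards [hM.eventually_gt_atTop 0] with n hn
  exact abs_cellIndex_div_sub_le hn ht

/-- The `p`-variation sum of the discretization of `x` at level `n`. -/
lemma sum_norm_cellIndex_sub_rpow_le {E : Type*} [NormedAddCommGroup E] {p γ A : ℝ} (hp : 1 ≤ p)
    (hA : 0 ≤ A) (hHolder : ∀ (n : ℕ) (u : ℕ → ℝ), (∀ k, 0 ≤ u k) →
      (∑ k ∈ Finset.range n, u k) ^ p ≤ A * ∑ k ∈ Finset.range n, ((k : ℝ) + 1) ^ γ * u k ^ p)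
    {K : ℕ} {η : ℕ → ℕ} (hη : ∀ i, 0 < η i ∧ η i ≤ K) (x : ℝ → E) {N : ℕ} {t : ℕ → ℝ}
    (ht : ∀ i < N, t i ≤ t (i + 1)) (M : ℕ → ℕ) (hM0 : M 0 = 1)
    (hM : ∀ n, M (n + 1) = M n * η n) (n : ℕ) :
    ∑ i ∈ Finset.range N, ‖x (cellIndex (M n) (t (i + 1)) / M n) -
        x (cellIndex (M n) (t i) / M n)‖ ^ p ≤
      A * (2 * (2 ^ (p - 1) * (K : ℝ) ^ (p - 1))) * ∑ k ∈ Finset.range n, ((k : ℝ) + 1) ^ γ *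
        ∑ l ∈ Finset.range (M (k + 1)), ‖x (((l : ℝ) + 1) / M (k + 1)) - x (l / M (k + 1))‖ ^ p := by
  have hMpos (k : ℕ) : 0 < M k := by
    induction k with
    | zero => simp [hM0]
    | succ k ih => rw [hM]; exact Nat.mul_pos ih (hη k).1
  set X : ℕ → ℝ → E := fun k s => x (cellIndex (M k) s / M k) with hX
  have hX0 (s : ℝ) : X 0 s = x 0 := by simp [hX, cellIndex, hM0]
  set D : ℕ → ℕ → E := fun i k =>
    (X (k + 1) (t (i + 1)) - X k (t (i + 1))) - (X (k + 1) (t i) - X k (t i)) with hD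
  have hsplit (i : ℕ) : X n (t (i + 1)) - X n (t i) = ∑ k ∈ Finset.range n, D i k := by
    rw [hD, Finset.sum_sub_distrib, Finset.sum_range_sub (fun k => X k (t (i + 1))),
      Finset.sum_range_sub (fun k => X k (t i)), hX0, hX0]
    abel
  have hlevel (k : ℕ) : ∑ i ∈ Finset.range N, ‖D i k‖ ^ p ≤ 2 * (2 ^ (p - 1) * (K : ℝ) ^ (p - 1)) *
      ∑ l ∈ Finset.range (M (k + 1)), ‖x (((l : ℝ) + 1) / M (k + 1)) - x (l / M (k + 1))‖ ^ p := by
    have hparent (s : ℝ) : X k s =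
        x ((η k * (cellIndex (M (k + 1)) s / η k) : ℕ) / M (k + 1)) := by
      have hq : (η k : ℝ) ≠ 0 := by exact_mod_cast (hη k).1.ne'
      rw [hM, cellIndex_mul_div _ (hMpos k) (hη k).1]
      push_cast
      rw [mul_comm (M k : ℝ), mul_div_mul_left _ _ hq]
    have h := sum_norm_block_sub_rpow_le hp (fun l : ℕ => x (l / M (k + 1))) (hη k).1 (hη k).2
      (a := fun i => cellIndex (M (k + 1)) (t i)) (M := M (k + 1))
      (fun i hi => cellIndex_mono _ (ht i hi)) ((min_le_right _ _).trans (Nat.sub_le _ _))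
    simp only [← hparent] at h
    simpa only [Nat.cast_add, Nat.cast_one] using h
  calc ∑ i ∈ Finset.range N, ‖X n (t (i + 1)) - X n (t i)‖ ^ p
      ≤ ∑ i ∈ Finset.range N, A * ∑ k ∈ Finset.range n, ((k : ℝ) + 1) ^ γ * ‖D i k‖ ^ p := by
        refine Finset.sum_le_sum fun i _ => ?_
        rw [hsplit]
        refine le_trans ?_ (hHolder n (fun k => ‖D i k‖) fun _ => norm_nonneg _)
        gcongr
        exact norm_sum_le _ _
    _ = A * ∑ k ∈ Finset.range n, ((k : ℝ) + 1) ^ γ * ∑ i ∈ Finset.range N, ‖D i k‖ ^ p := by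
        rw [← Finset.mul_sum, Finset.sum_comm]
        simp only [Finset.mul_sum]
    _ ≤ A * ∑ k ∈ Finset.range n, ((k : ℝ) + 1) ^ γ * (2 * (2 ^ (p - 1) * (K : ℝ) ^ (p - 1)) *
          ∑ l ∈ Finset.range (M (k + 1)),
            ‖x (((l : ℝ) + 1) / M (k + 1)) - x (l / M (k + 1))‖ ^ p) := by
        gcongr with k
        exact hlevel k
    _ = _ := by
        rw [mul_assoc A, Finset.mul_sum (a := 2 * (2 ^ (p - 1) * (K : ℝ) ^ (p - 1)))]
        congr 1
        exact Finset.sum_congr rfl fun k _ => by ring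


/-- For `p > 1`, `γ > p − 1` and an integer `K ≥ 2`, there is a constant
`c = c(K, p, γ)`, independent of the particular sequence `(η_i)` with
`2 ≤ η_i ≤ K`, such that for the nested uniform partitions with `M_n = η_1 ⋯ η_n`
points `t^n_l = l / M_n`, and every continuous `x : [0,1] → ℝ^d`, the `p`-variation
of `x` is at most `c Σ_{n≥1} n^γ Σ_{l=1}^{M_n} |x(t^n_l) − x(t^n_{l−1})|^p`. -/
theorem generalized_dyadic_variation_bound
    (p γ : ℝ) (hp : 1 < p) (hγ : p - 1 < γ) (K : ℕ) (hK : 2 ≤ K) :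
    ∃ c : ℝ, ∀ η : ℕ → ℕ, (∀ i, 2 ≤ η i ∧ η i ≤ K) →
      ∀ (d : ℕ) (x : ℝ → EuclideanSpace ℝ (Fin d)), ContinuousOn x (Icc 0 1) →
      ∀ S ∈ varSums p x,
        ENNReal.ofReal S ≤ ENNReal.ofReal c *
          ∑' n : ℕ, ENNReal.ofReal (((n : ℝ) + 1) ^ γ) *
            ∑ l ∈ Finset.range (∏ i ∈ Finset.range (n + 1), η i),
              ENNReal.ofReal
                (‖x (((l : ℝ) + 1) / ((∏ i ∈ Finset.range (n + 1), η i : ℕ) : ℝ)) -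
                  x ((l : ℝ) / ((∏ i ∈ Finset.range (n + 1), η i : ℕ) : ℝ))‖ ^ p) := by
  obtain ⟨A, hA, hHolder⟩ := exists_sum_rpow_le_weighted hp hγ
  refine ⟨A * (2 * (2 ^ (p - 1) * (K : ℝ) ^ (p - 1))), ?_⟩
  rintro η hη d x hx S ⟨N, t, ht0, htN, ht, rfl⟩
  set M : ℕ → ℕ := fun n => ∏ i ∈ Finset.range n, η i
  have hM (n : ℕ) : M (n + 1) = M n * η n := Finset.prod_range_succ _ _
  have hMtop : Tendsto M atTop atTop := by
    refine tendsto_atTop_mono (fun n => ?_) (tendsto_pow_atTop_atTop_of_one_lt one_lt_two)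
    calc 2 ^ n = ∏ _i ∈ Finset.range n, 2 := by simp
      _ ≤ M n := Finset.prod_le_prod' fun i _ => (hη i).1
  have hmono {i j : ℕ} (hij : i ≤ j) (hj : j ≤ N) : t i ≤ t j := by
    induction j, hij using Nat.le_induction with
    | base => rfl
    | succ j _ ih => exact (ih (by omega)).trans (ht j (by omega)).le
  have hmem {i : ℕ} (hi : i ≤ N) : t i ∈ Icc (0 : ℝ) 1 :=
    ⟨ht0 ▸ hmono (Nat.zero_le i) hi, htN ▸ hmono hi le_rfl⟩
  have hlim {i : ℕ} (hi : i ≤ N) :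
      Tendsto (fun n => x (cellIndex (M n) (t i) / M n)) atTop (𝓝 (x (t i))) :=
    (hx _ (hmem hi)).tendsto.comp (tendsto_nhdsWithin_iff.2
      ⟨tendsto_cellIndex_div hMtop (hmem hi), .of_forall fun n => cellIndex_div_mem_Icc _ _⟩)
  have hsum : Tendsto (fun n => ∑ i ∈ Finset.range N, ‖x (cellIndex (M n) (t (i + 1)) / M n) -
      x (cellIndex (M n) (t i) / M n)‖ ^ p) atTop
      (𝓝 (∑ i ∈ Finset.range N, ‖x (t (i + 1)) - x (t i)‖ ^ p)) := by
    refine tendsto_finsetSum _ fun i hi => ?_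
    have hi := Finset.mem_range.1 hi
    exact ((hlim hi).sub (hlim hi.le)).norm.rpow_const (Or.inr (by linarith))
  refine le_of_tendsto (ENNReal.tendsto_ofReal hsum) (.of_forall fun n => ?_)
  refine (ENNReal.ofReal_le_ofReal (sum_norm_cellIndex_sub_rpow_le hp.le hA hHolder
    (fun i => ⟨by linarith [(hη i).1], (hη i).2⟩) x (fun i hi => (ht i hi).le) M (by simp [M]) hM
    n)).trans ?_
  rw [ENNReal.ofReal_mul (by positivity), ENNReal.ofReal_sum_of_nonneg fun _ _ => by positivity]
  refine mul_le_mul_right (le_trans (Finset.sum_le_sum fun k _ => ?_)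
    (ENNReal.sum_le_tsum (Finset.range n))) _
  rw [ENNReal.ofReal_mul (by positivity), ENNReal.ofReal_sum_of_nonneg fun _ _ => by positivity]
end

section
/- Let p ≥ 2, γ > p − 1, and let K ≥ 2 be an integer. Let (η_i)_{i≥1} be a sequence of integers with 2 ≤ η_i ≤ K; set M_n = η_1 ⋯ η_n and t^n_l = l/M_n. Let x, y : [0,1] → ℝ^d be continuous, and let A, B : {(s,t) : 0 ≤ s ≤ t ≤ 1} → ℝ^{d×d} be continuous functions vanishing on the diagonal and satisfying Chen's identity: A(s,t) = A(s,u) + A(u,t) + (x(u) − x(s)) ⊗ (x(t) − x(u)) for all 0 ≤ s ≤ u ≤ t ≤ 1, where (v ⊗ w)_{ij} = v_i w_j, and similarly for B with y in place of x. Define D_1(z) = (Σ_{n=1}^∞ n^γ Σ_{l=1}^{M_n} |z(t^n_l) − z(t^n_{l−1})|^p)^{1/p} for a path z, and D_2(C) = (Σ_{n=1}^∞ n^γ Σ_{l=1}^{M_n} ‖C(t^n_{l−1}, t^n_l)‖^{p/2})^{2/p} for a two-parameter function C. Then there exists a constant c depending only on K, p and γ such that the supremum over all finite partitions 0 = t_0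 < ⋯ < t_N = 1 of Σ_{i=1}^N ‖A(t_{i−1}, t_i) − B(t_{i−1}, t_i)‖^{p/2} is at most c · [ D_2(A − B)^{p/2} + D_1(x − y)^{p/2} · (D_1(x)^p + D_1(y)^p)^{1/2} ] (trivially true if the right-hand side is infinite). -/
open Set Finset
open scoped ENNReal

/-- The outer product `v ⊗ w` of two vectors of `ℝ^d`, viewed as an element of the
Euclidean space `ℝ^{d×d}` (so that its norm is the Frobenius norm). -/
noncomputable def outer {d : ℕ} (v w : EuclideanSpace ℝ (Fin d)) :
    EuclideanSpace ℝ (Fin d × Fin d) :=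
  (WithLp.equiv 2 ((Fin d × Fin d) → ℝ)).symm fun q => v q.1 * w q.2

/-- `D_1(z) = (Σ_{n≥1} n^γ Σ_{l=1}^{M_n} |z(t^n_l) − z(t^n_{l−1})|^p)^{1/p}` for a path `z`,
where `t^n_l = l / M_n`. -/
noncomputable def D1 (p γ : ℝ) (M : ℕ → ℕ) {d : ℕ} (z : ℝ → EuclideanSpace ℝ (Fin d)) :
    ℝ≥0∞ :=
  (∑' n : ℕ, ENNReal.ofReal (((n : ℝ) + 1) ^ γ) *
      ∑ l ∈ Finset.range (M (n + 1)),
        ENNReal.ofReal (‖z (((l : ℝ) + 1) / (M (n + 1) : ℝ)) -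
          z ((l : ℝ) / (M (n + 1) : ℝ))‖ ^ p)) ^ (1 / p)

/-- `D_2(C) = (Σ_{n≥1} n^γ Σ_{l=1}^{M_n} ‖C(t^n_{l−1}, t^n_l)‖^{p/2})^{2/p}` for a
two-parameter function `C`, where `t^n_l = l / M_n`. -/
noncomputable def D2 (p γ : ℝ) (M : ℕ → ℕ) {d : ℕ}
    (C : ℝ → ℝ → EuclideanSpace ℝ (Fin d × Fin d)) : ℝ≥0∞ :=
  (∑' n : ℕ, ENNReal.ofReal (((n : ℝ) + 1) ^ γ) *
      ∑ l ∈ Finset.range (M (n + 1)),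
        ENNReal.ofReal (‖C ((l : ℝ) / (M (n + 1) : ℝ))
          (((l : ℝ) + 1) / (M (n + 1) : ℝ))‖ ^ (p / 2))) ^ (2 / p)

theorem norm_outer {d : ℕ} (v w : EuclideanSpace ℝ (Fin d)) : ‖outer v w‖ = ‖v‖ * ‖w‖ := by
  rw [EuclideanSpace.norm_eq, EuclideanSpace.norm_eq, EuclideanSpace.norm_eq,
    ← Real.sqrt_mul (Finset.sum_nonneg fun _ _ => by positivity), Finset.sum_mul_sum,
    Fintype.sum_prod_type]
  simp [outer, mul_pow]

theorem outer_sub_outer {d : ℕ} (a b a' b' : EuclideanSpace ℝ (Fin d)) :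
    outer a b - outer a' b' = outer (a - a') b + outer a' (b - b') := by
  ext q
  simp only [outer, WithLp.equiv_symm_apply, PiLp.sub_apply, PiLp.add_apply]
  ring

/-- The sum of `g` over the cells between the left end point of the parent of the cell `a`
and the left end point of `a`, when every parent has `e` children. -/
def cellVar (g : ℕ → ℝ) (e a : ℕ) : ℝ := ∑ l ∈ Finset.Ico (e * (a / e)) a, g l

/-- The contribution of the level `n + 1` to the telescoping of an increment whose end points
lie in the cells `a (n + 1)` and `b (n + 1)`. -/
def stepVar (g : ℕ → ℕ → ℝ) (η a b : ℕ → ℕ) (n : ℕ) : ℝ :=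
  if a (n + 1) = b (n + 1) then 0
  else cellVar (g n) (η n) (a (n + 1)) + cellVar (g n) (η n) (b (n + 1))

/-- The norms of the increments of `z` over the cells of the partition into `M (n + 1)` cells. -/
noncomputable def pathIncr {E : Type*} [NormedAddCommGroup E] (M : ℕ → ℕ) (z : ℝ → E)
    (n l : ℕ) : ℝ :=
  ‖z (((l : ℝ) + 1) / (M (n + 1) : ℝ)) - z ((l : ℝ) / (M (n + 1) : ℝ))‖

/-- The norms of the values of `C` on the cells of the partition into `M (n + 1)` cells. -/
noncomputable def areaIncr {E : Type*} [NormedAddCommGroup E] (M : ℕ → ℕ) (C : ℝ → ℝ → E)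
    (n l : ℕ) : ℝ :=
  ‖C ((l : ℝ) / (M (n + 1) : ℝ)) (((l : ℝ) + 1) / (M (n + 1) : ℝ))‖

/-- `C` is additive up to an error controlled by products of increments of `w`, `x` and `y`. -/
def AlmostAdditive {E F : Type*} [NormedAddCommGroup E] [NormedAddCommGroup F]
    (w x y : ℝ → E) (C : ℝ → ℝ → F) : Prop :=
  ∀ s u t : ℝ, 0 ≤ s → s ≤ u → u ≤ t → t ≤ 1 →
    ‖C s t - C s u - C u t‖ ≤ ‖w u - w s‖ * ‖x t - x u‖ + ‖y u - y s‖ * ‖w t - w u‖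

theorem cellVar_nonneg {g : ℕ → ℝ} (hg : ∀ l, 0 ≤ g l) (e a : ℕ) : 0 ≤ cellVar g e a :=
  Finset.sum_nonneg fun _ _ => hg _

theorem stepVar_nonneg {g : ℕ → ℕ → ℝ} (hg : ∀ n l, 0 ≤ g n l) (η a b : ℕ → ℕ) (n : ℕ) :
    0 ≤ stepVar g η a b n := by
  unfold stepVar
  split_ifs
  · exact le_rfl
  · exact add_nonneg (cellVar_nonneg (hg n) _ _) (cellVar_nonneg (hg n) _ _)

section Telescoping

variable {E F : Type*} [NormedAddCommGroup E] [NormedAddCommGroup F]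

theorem AlmostAdditive.norm_le {w x y : ℝ → E} {C : ℝ → ℝ → F} (hC : AlmostAdditive w x y C)
    {s u t : ℝ} (hs : 0 ≤ s) (hsu : s ≤ u) (hut : u ≤ t) (ht : t ≤ 1) :
    ‖C s t‖ ≤ ‖C s u‖ + ‖C u t‖ + (‖w u - w s‖ * ‖x t - x u‖ + ‖y u - y s‖ * ‖w t - w u‖) := by
  have h := hC s u t hs hsu hut ht
  have h1 := norm_sub_norm_le (C s t - C s u) (C u t)
  have h2 := norm_sub_norm_le (C s t) (C s u)
  linarith

theorem AlmostAdditive.norm_le_of_left {w x y : ℝ → E} {C : ℝ → ℝ → F}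
    (hC : AlmostAdditive w x y C) {s u t : ℝ} (hs : 0 ≤ s) (hsu : s ≤ u) (hut : u ≤ t)
    (ht : t ≤ 1) :
    ‖C u t‖ ≤ ‖C s u‖ + ‖C s t‖ + (‖w u - w s‖ * ‖x t - x u‖ + ‖y u - y s‖ * ‖w t - w u‖) := by
  have h := hC s u t hs hsu hut ht
  have h1 := norm_sub_norm_le (C u t) (C s t - C s u)
  have h2 := norm_sub_le (C s t) (C s u)
  rw [norm_sub_rev (C u t)] at h1
  linarith

theorem norm_path_sub_le (M : ℕ → ℕ) (z : ℝ → E) (n : ℕ) {k l : ℕ} (hkl : k ≤ l) :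
    ‖z ((l : ℝ) / M (n + 1)) - z ((k : ℝ) / M (n + 1))‖ ≤
      ∑ j ∈ Finset.Ico k l, pathIncr M z n j := by
  have h := dist_le_Ico_sum_dist (fun j : ℕ => z ((j : ℝ) / M (n + 1))) hkl
  rw [dist_comm, dist_eq_norm] at h
  refine h.trans (Finset.sum_le_sum fun j _ => ?_)
  rw [dist_comm, dist_eq_norm, pathIncr]
  push_cast
  exact le_rfl

theorem norm_area_le {w x y : ℝ → E} {C : ℝ → ℝ → F} (hC : AlmostAdditive w x y C)
    (hC0 : ∀ s, 0 ≤ s → s ≤ 1 → C s s = 0) (M : ℕ → ℕ) (n : ℕ) {k l : ℕ} (hkl : k ≤ l)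
    (hl : l ≤ M (n + 1)) :
    ‖C ((k : ℝ) / M (n + 1)) ((l : ℝ) / M (n + 1))‖ ≤
      ∑ j ∈ Finset.Ico k l, areaIncr M C n j +
        (∑ j ∈ Finset.Ico k l, pathIncr M w n j) *
          (∑ j ∈ Finset.Ico k l, pathIncr M x n j + ∑ j ∈ Finset.Ico k l, pathIncr M y n j) := by
  induction l, hkl using Nat.le_induction with
  | base =>
    rw [hC0 _ (by positivity) (div_le_one_of_le₀ (by exact_mod_cast hl) (by positivity))]
    simp
  | succ l hkl ih =>
    have ih := ih (by omega)
    have hw := norm_path_sub_le M w n hkl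
    have hy := norm_path_sub_le M y n hkl
    simp only [Finset.sum_Ico_succ_top hkl]
    have hx0 : ‖x (((l + 1 : ℕ) : ℝ) / M (n + 1)) - x ((l : ℝ) / M (n + 1))‖ =
      pathIncr M x n l := by simp [pathIncr]
    have hw0 : ‖w (((l + 1 : ℕ) : ℝ) / M (n + 1)) - w ((l : ℝ) / M (n + 1))‖ =
      pathIncr M w n l := by simp [pathIncr]
    have hc0 : ‖C ((l : ℝ) / M (n + 1)) (((l + 1 : ℕ) : ℝ) / M (n + 1))‖ =
      areaIncr M C n l := by simp [areaIncr]
    have htri := hC.norm_le (s := (k : ℝ) / M (n + 1)) (u := (l : ℝ) / M (n + 1))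
      (t := ((l + 1 : ℕ) : ℝ) / M (n + 1)) (by positivity) (by gcongr) (by gcongr; omega)
      (div_le_one_of_le₀ (by exact_mod_cast hl) (by positivity))
    rw [hx0, hw0, hc0] at htri
    have hwn := norm_nonneg (w (((l + 1 : ℕ) : ℝ) / M (n + 1)) - w ((l : ℝ) / M (n + 1)))
    have hxn := norm_nonneg (x (((l + 1 : ℕ) : ℝ) / M (n + 1)) - x ((l : ℝ) / M (n + 1)))
    rw [hw0] at hwn
    rw [hx0] at hxn
    have hyn : 0 ≤ pathIncr M y n l := norm_nonneg _
    have hX : 0 ≤ ∑ j ∈ Finset.Ico k l, pathIncr M x n j :=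
      Finset.sum_nonneg fun _ _ => norm_nonneg _
    have hW := (norm_nonneg _).trans hw
    have h1 := mul_le_mul_of_nonneg_right hw hxn
    have h2 := mul_le_mul_of_nonneg_right hy hwn
    have h3 := mul_nonneg hX hwn
    have h4 := mul_nonneg hW hyn
    have h5 := mul_nonneg hwn (add_nonneg hxn hyn)
    linarith

theorem norm_area_le_stepVar {w x y : ℝ → E} {C : ℝ → ℝ → F} (hC : AlmostAdditive w x y C)
    (hC0 : ∀ s, 0 ≤ s → s ≤ 1 → C s s = 0) {M η a b : ℕ → ℕ} (hη : ∀ n, 0 < η n)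
    (hM : ∀ n, M (n + 1) = M n * η n) (ha : ∀ n, a n = a (n + 1) / η n)
    (hb : ∀ n, b n = b (n + 1) / η n) (hab : ∀ n, a n ≤ b n) (hbM : ∀ n, b n ≤ M n)
    (h0 : a 0 = b 0) (m : ℕ) :
    ‖C ((a m : ℝ) / M m) ((b m : ℝ) / M m)‖ ≤
      ∑ n ∈ Finset.range m, stepVar (areaIncr M C) η a b n +
        2 * ((∑ n ∈ Finset.range m, stepVar (pathIncr M w) η a b n) *
          (∑ n ∈ Finset.range m, stepVar (pathIncr M x) η a b n +
            ∑ n ∈ Finset.range m, stepVar (pathIncr M y) η a b n)) := by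
  have hE (z : ℝ → E) (m : ℕ) : 0 ≤ ∑ n ∈ Finset.range m, stepVar (pathIncr M z) η a b n :=
    Finset.sum_nonneg fun _ _ => stepVar_nonneg (fun _ _ => norm_nonneg _) _ _ _ _
  have haM (n : ℕ) : a n ≤ M n := (hab n).trans (hbM n)
  have hv1 (n : ℕ) : (b n : ℝ) / M n ≤ 1 :=
    div_le_one_of_le₀ (by exact_mod_cast hbM n) (by positivity)
  have huv (n : ℕ) : (a n : ℝ) / M n ≤ (b n : ℝ) / M n := by
    gcongr
    exact hab n
  have hlift {c : ℕ → ℕ} (hc : ∀ n, c n = c (n + 1) / η n) (n : ℕ) :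
      (c n : ℝ) / M n = ((η n * (c (n + 1) / η n) : ℕ) : ℝ) / M (n + 1) := by
    have : (η n : ℝ) ≠ 0 := by exact_mod_cast (hη n).ne'
    rw [← hc, hM]
    push_cast
    rw [mul_comm (M n : ℝ), mul_div_mul_left _ _ this]
  have hmono {c : ℕ → ℕ} (hc : ∀ n, c n = c (n + 1) / η n) (n : ℕ) :
      (c n : ℝ) / M n ≤ (c (n + 1) : ℝ) / M (n + 1) := by
    rw [hlift hc n]
    gcongr
    exact Nat.mul_div_le _ _
  have hpath {c : ℕ → ℕ} (hc : ∀ n, c n = c (n + 1) / η n) (z : ℝ → E) (n : ℕ) :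
      ‖z ((c (n + 1) : ℝ) / M (n + 1)) - z ((c n : ℝ) / M n)‖ ≤
        cellVar (pathIncr M z n) (η n) (c (n + 1)) := by
    rw [hlift hc n]
    exact norm_path_sub_le M z n (Nat.mul_div_le _ _)
  have harea {c : ℕ → ℕ} (hc : ∀ n, c n = c (n + 1) / η n) (hcM : ∀ n, c n ≤ M n) (n : ℕ) :
      ‖C ((c n : ℝ) / M n) ((c (n + 1) : ℝ) / M (n + 1))‖ ≤
        cellVar (areaIncr M C n) (η n) (c (n + 1)) +
          cellVar (pathIncr M w n) (η n) (c (n + 1)) *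
            (cellVar (pathIncr M x n) (η n) (c (n + 1)) +
              cellVar (pathIncr M y n) (η n) (c (n + 1))) := by
    rw [hlift hc n]
    exact norm_area_le hC hC0 M n (Nat.mul_div_le _ _) (hcM _)
  have hz (z : ℝ → E) (m : ℕ) : ‖z ((b m : ℝ) / M m) - z ((a m : ℝ) / M m)‖ ≤
      ∑ n ∈ Finset.range m, stepVar (pathIncr M z) η a b n := by
    induction m with
    | zero => simp [h0]
    | succ m ih =>
      by_cases h : a (m + 1) = b (m + 1)
      · rw [h, sub_self, norm_zero]
        exact hE z _
      · rw [Finset.sum_range_succ, stepVar, if_neg h]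
        have h1 := hpath ha z m
        have h2 := hpath hb z m
        have h3 := norm_sub_le_norm_sub_add_norm_sub (z ((b (m + 1) : ℝ) / M (m + 1)))
          (z ((b m : ℝ) / M m)) (z ((a (m + 1) : ℝ) / M (m + 1)))
        have h4 := norm_sub_le_norm_sub_add_norm_sub (z ((b m : ℝ) / M m))
          (z ((a m : ℝ) / M m)) (z ((a (m + 1) : ℝ) / M (m + 1)))
        rw [norm_sub_rev (z ((a m : ℝ) / M m))] at h4
        linarith
  induction m with
  | zero => simp [h0, hC0 _ (by positivity : (0 : ℝ) ≤ (b 0 : ℝ) / M 0) (hv1 0)]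
  | succ m ih =>
    by_cases h : a (m + 1) = b (m + 1)
    · rw [h, hC0 _ (by positivity) (hv1 _), norm_zero]
      exact add_nonneg
        (Finset.sum_nonneg fun _ _ => stepVar_nonneg (fun _ _ => norm_nonneg _) _ _ _ _)
        (mul_nonneg zero_le_two (mul_nonneg (hE w _) (add_nonneg (hE x _) (hE y _))))
    · have hR1 := hC.norm_le (by positivity) (huv m) (hmono hb m) (hv1 _)
      have hR2 := hC.norm_le_of_left (by positivity) (hmono ha m) (huv (m + 1)) (hv1 _)
      have hAa := harea ha haM m
      have hAb := harea hb hbM m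
      have hwE := hz w m
      have hyE := hz y m
      have hwE' := hz w (m + 1)
      have hxE' := hz x (m + 1)
      have hwa := hpath ha w m
      have hya := hpath ha y m
      have hwb := hpath hb w m
      have hxb := hpath hb x m
      have hc (z : ℝ → E) (c : ℕ) : 0 ≤ cellVar (pathIncr M z m) (η m) c :=
        cellVar_nonneg (fun _ => norm_nonneg _) _ _
      have p1 := mul_le_mul hwE hxb (norm_nonneg _) (hE w m)
      have p2 := mul_le_mul hyE hwb (norm_nonneg _) (hE y m)
      have p3 := mul_le_mul hwa hxE' (norm_nonneg _) (hc w _)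
      have p4 := mul_le_mul hya hwE' (norm_nonneg _) (hc y _)
      have hstep (g : ℕ → ℕ → ℝ) : stepVar g η a b m =
          cellVar (g m) (η m) (a (m + 1)) + cellVar (g m) (η m) (b (m + 1)) := if_neg h
      simp only [Finset.sum_range_succ, hstep] at p3 p4 ⊢
      have hW := hE w m
      have hX := hE x m
      have hY := hE y m
      have q1 := hc w (a (m + 1))
      have q2 := hc x (a (m + 1))
      have q3 := hc y (a (m + 1))
      have q4 := hc w (b (m + 1))
      have q5 := hc x (b (m + 1))
      have q6 := hc y (b (m + 1))
      linarith [mul_nonneg hW q2, mul_nonneg hW q3, mul_nonneg hW q5, mul_nonneg hW q6,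
        mul_nonneg q1 hX, mul_nonneg q1 hY, mul_nonneg q4 hX, mul_nonneg q4 hY,
        mul_nonneg q1 q2, mul_nonneg q1 q3, mul_nonneg q1 q5, mul_nonneg q1 q6,
        mul_nonneg q4 q2, mul_nonneg q4 q3, mul_nonneg q4 q5, mul_nonneg q4 q6]

end Telescoping

theorem add_rpow_le_two_rpow_mul {q u v : ℝ} (hq : 1 ≤ q) (hu : 0 ≤ u) (hv : 0 ≤ v) :
    (u + v) ^ q ≤ 2 ^ (q - 1) * (u ^ q + v ^ q) := by
  have h := Real.rpow_sum_le_const_mul_sum_rpow (Finset.univ : Finset (Fin 2)) ![u, v] hq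
  simpa [abs_of_nonneg, hu, hv] using h

theorem sum_cells_le {K e N : ℕ} (he : 0 < e) (heK : e ≤ K) {h : ℕ → ℝ} (hh : ∀ l, 0 ≤ h l)
    {T : Finset ℕ} {a : ℕ → ℕ} (hinj : Set.InjOn a T) (haN : ∀ i ∈ T, a i ≤ N) :
    ∑ i ∈ T, ∑ l ∈ Finset.Ico (e * (a i / e)) (a i), h l ≤ K * ∑ l ∈ Finset.range N, h l := by
  have hswap : ∑ i ∈ T, ∑ l ∈ Finset.Ico (e * (a i / e)) (a i), h l =
      ∑ l ∈ Finset.range N, ∑ i ∈ T with e * (a i / e) ≤ l ∧ l < a i, h l := by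
    refine Finset.sum_comm' fun i l => ?_
    simp only [Finset.mem_Ico, Finset.mem_range, Finset.mem_filter]
    constructor
    · rintro ⟨hi, hl⟩
      exact ⟨⟨hi, hl⟩, hl.2.trans_le (haN i hi)⟩
    · rintro ⟨hi, -⟩
      exact hi
  rw [hswap, Finset.mul_sum]
  refine Finset.sum_le_sum fun l _ => ?_
  rw [Finset.sum_const, nsmul_eq_mul]
  refine mul_le_mul_of_nonneg_right ?_ (hh l)
  have hcard : (T.filter fun i => e * (a i / e) ≤ l ∧ l < a i).card ≤
      (Finset.Ioc l (l + e)).card := by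
    refine Finset.card_le_card_of_injOn a (fun i hi => ?_)
      (hinj.mono fun i hi => (Finset.mem_filter.1 hi).1)
    have hi := (Finset.mem_filter.1 (Finset.mem_coe.1 hi)).2
    have := Nat.div_add_mod (a i) e
    have := Nat.mod_lt (a i) he
    simp only [Finset.coe_Ioc, Set.mem_Ioc]
    omega
  rw [Nat.card_Ioc] at hcard
  exact_mod_cast (show _ ≤ K by omega)

theorem cellVar_rpow_le {K e : ℕ} (he : 0 < e) (heK : e ≤ K) {q : ℝ} (hq : 1 ≤ q) {g : ℕ → ℝ}
    (hg : ∀ l, 0 ≤ g l) (a : ℕ) :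
    cellVar g e a ^ q ≤ (K : ℝ) ^ (q - 1) * ∑ l ∈ Finset.Ico (e * (a / e)) a, g l ^ q := by
  refine (Real.rpow_sum_le_const_mul_sum_rpow_of_nonneg _ hq fun l _ => hg l).trans ?_
  refine mul_le_mul_of_nonneg_right ?_ (Finset.sum_nonneg fun l _ => Real.rpow_nonneg (hg l) _)
  refine Real.rpow_le_rpow (by positivity) ?_ (by linarith)
  have := Nat.div_add_mod a e
  have := Nat.mod_lt a he
  rw [Nat.card_Ico]
  exact_mod_cast (show _ ≤ K by omega)

/-- The factor by which passing from cells to intervals of an arbitrary partition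
increases sums of `q`-th powers. -/
noncomputable def multConst (K : ℕ) (q : ℝ) : ℝ := 2 ^ (q - 1) * (2 * (K : ℝ) ^ (q - 1) * K)

theorem multConst_nonneg (K : ℕ) (q : ℝ) : 0 ≤ multConst K q := by
  unfold multConst
  positivity

theorem sum_stepVar_rpow_le {K : ℕ} {η M : ℕ → ℕ} (hη : ∀ n, 0 < η n) (hηK : ∀ n, η n ≤ K)
    {q : ℝ} (hq : 1 ≤ q) {g : ℕ → ℕ → ℝ} (hg : ∀ n l, 0 ≤ g n l) {N : ℕ} {φ : ℕ → ℕ → ℕ}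
    (hφ : ∀ n, MonotoneOn (fun i => φ i n) (Set.Iic N)) (hφM : ∀ i ≤ N, ∀ n, φ i n ≤ M n)
    (n : ℕ) :
    ∑ i ∈ Finset.range N, stepVar g η (φ i) (φ (i + 1)) n ^ q ≤
      multConst K q * ∑ l ∈ Finset.range (M (n + 1)), g n l ^ q := by
  set T := (Finset.range N).filter fun i => φ i (n + 1) ≠ φ (i + 1) (n + 1) with hT
  have hmem {i : ℕ} (hi : i ∈ T) : i < N ∧ φ i (n + 1) < φ (i + 1) (n + 1) := by
    rw [hT, Finset.mem_filter, Finset.mem_range] at hi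
    exact ⟨hi.1, lt_of_le_of_ne (hφ (n + 1) (Set.mem_Iic.2 hi.1.le) (Set.mem_Iic.2 hi.1)
      i.le_succ) hi.2⟩
  have hq0 : q ≠ 0 := by linarith
  have hlt {i j : ℕ} (hi : i ∈ T) (hj : j ∈ T) (hij : i < j) :
      φ i (n + 1) < φ j (n + 1) ∧ φ (i + 1) (n + 1) < φ (j + 1) (n + 1) := by
    have h1 := hmem hi
    have h2 := hmem hj
    have h3 := hφ (n + 1) (Set.mem_Iic.2 h1.1) (Set.mem_Iic.2 h2.1.le) hij
    exact ⟨h1.2.trans_le h3, lt_of_le_of_lt h3 h2.2⟩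
  have hinj1 : Set.InjOn (fun i => φ i (n + 1)) T :=
    StrictMonoOn.injOn fun i hi j hj hij => (hlt hi hj hij).1
  have hinj2 : Set.InjOn (fun i => φ (i + 1) (n + 1)) T :=
    StrictMonoOn.injOn fun i hi j hj hij => (hlt hi hj hij).2
  have hgq (l : ℕ) : 0 ≤ g n l ^ q := Real.rpow_nonneg (hg n l) q
  have hsum : ∑ i ∈ Finset.range N, stepVar g η (φ i) (φ (i + 1)) n ^ q =
      ∑ i ∈ T, (cellVar (g n) (η n) (φ i (n + 1)) +
        cellVar (g n) (η n) (φ (i + 1) (n + 1))) ^ q := by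
    rw [hT, Finset.sum_filter]
    refine Finset.sum_congr rfl fun i _ => ?_
    by_cases h : φ i (n + 1) = φ (i + 1) (n + 1) <;> simp [stepVar, h, Real.zero_rpow hq0]
  have h1 := sum_cells_le (hη n) (hηK n) hgq hinj1 fun i hi => hφM i (hmem hi).1.le (n + 1)
  have h2 := sum_cells_le (hη n) (hηK n) hgq hinj2 fun i hi => hφM (i + 1) (hmem hi).1 (n + 1)
  rw [hsum]
  calc _ ≤ ∑ i ∈ T, 2 ^ (q - 1) *
        ((K : ℝ) ^ (q - 1) * ∑ l ∈ Finset.Ico (η n * (φ i (n + 1) / η n)) (φ i (n + 1)),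
            g n l ^ q +
          (K : ℝ) ^ (q - 1) * ∑ l ∈ Finset.Ico (η n * (φ (i + 1) (n + 1) / η n))
            (φ (i + 1) (n + 1)), g n l ^ q) := by
        refine Finset.sum_le_sum fun i _ => ?_
        refine (add_rpow_le_two_rpow_mul hq (cellVar_nonneg (hg n) _ _)
          (cellVar_nonneg (hg n) _ _)).trans ?_
        gcongr <;> exact cellVar_rpow_le (hη n) (hηK n) hq (hg n) _
    _ = 2 ^ (q - 1) * ((K : ℝ) ^ (q - 1) *
        (∑ i ∈ T, ∑ l ∈ Finset.Ico (η n * (φ i (n + 1) / η n)) (φ i (n + 1)), g n l ^ q +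
          ∑ i ∈ T, ∑ l ∈ Finset.Ico (η n * (φ (i + 1) (n + 1) / η n)) (φ (i + 1) (n + 1)),
            g n l ^ q)) := by
        rw [← Finset.mul_sum, Finset.sum_add_distrib, ← Finset.mul_sum, ← Finset.mul_sum, ← mul_add]
    _ ≤ 2 ^ (q - 1) * ((K : ℝ) ^ (q - 1) *
        (K * ∑ l ∈ Finset.range (M (n + 1)), g n l ^ q +
          K * ∑ l ∈ Finset.range (M (n + 1)), g n l ^ q)) := by gcongr
    _ = _ := by
        unfold multConst
        ring

/-- Weighted Hölder inequality with the weights `(n + 1) ^ γ`. -/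
theorem exists_rpow_sum_le {p γ : ℝ} (hp : 1 < p) (hγ : p - 1 < γ) :
    ∃ W : ℝ, 0 ≤ W ∧ ∀ q, 1 ≤ q → q ≤ p → ∀ (e : ℕ → ℝ), (∀ n, 0 ≤ e n) → ∀ m,
      (∑ n ∈ Finset.range m, e n) ^ q ≤
        W ^ (q - 1) * ∑ n ∈ Finset.range m, ((n : ℝ) + 1) ^ γ * e n ^ q := by
  set α := γ / (p - 1) with hα
  have hp1 : 0 < p - 1 := by linarith
  have hα1 : 1 < α := (one_lt_div hp1).2 hγ
  have hs : Summable fun n : ℕ => (((n : ℝ) + 1) ^ α)⁻¹ := by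
    have := (summable_nat_add_iff 1).2 (Real.summable_nat_rpow_inv.2 hα1)
    simpa using this
  refine ⟨∑' n : ℕ, (((n : ℝ) + 1) ^ α)⁻¹, tsum_nonneg fun n => by positivity, ?_⟩
  intro q hq hqp e he m
  have h := Real.inner_le_weight_mul_Lp_of_nonneg (Finset.range m) hq
    (fun n : ℕ => (((n : ℝ) + 1) ^ α)⁻¹) (fun n => ((n : ℝ) + 1) ^ α * e n)
    (fun n => by positivity) (fun n => mul_nonneg (by positivity) (he n))
  have hq0 : 0 < q := by linarith
  have hcancel (n : ℕ) : (((n : ℝ) + 1) ^ α)⁻¹ * (((n : ℝ) + 1) ^ α * e n) = e n :=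
    inv_mul_cancel_left₀ (by positivity) _
  simp only [hcancel] at h
  have hsum_nonneg : 0 ≤ ∑ n ∈ Finset.range m,
      (((n : ℝ) + 1) ^ α)⁻¹ * (((n : ℝ) + 1) ^ α * e n) ^ q :=
    Finset.sum_nonneg fun n _ =>
      mul_nonneg (by positivity) (Real.rpow_nonneg (mul_nonneg (by positivity) (he n)) _)
  have h' := Real.rpow_le_rpow (Finset.sum_nonneg fun n _ => he n) h hq0.le
  rw [Real.mul_rpow (by positivity) (Real.rpow_nonneg hsum_nonneg _),
    ← Real.rpow_mul (by positivity), ← Real.rpow_mul hsum_nonneg, inv_mul_cancel₀ hq0.ne',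
    Real.rpow_one, sub_mul, one_mul, inv_mul_cancel₀ hq0.ne'] at h'
  refine h'.trans (mul_le_mul ?_ (Finset.sum_le_sum fun n _ => ?_) hsum_nonneg
    (Real.rpow_nonneg (tsum_nonneg fun n => by positivity) _))
  · exact Real.rpow_le_rpow (by positivity)
      (hs.sum_le_tsum _ fun n _ => by positivity) (by linarith)
  · have hn : (1 : ℝ) ≤ (n : ℝ) + 1 := by simp
    have hn0 : (0 : ℝ) < (n : ℝ) + 1 := by positivity
    rw [Real.mul_rpow (by positivity) (he n), ← mul_assoc, ← Real.rpow_mul hn0.le,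
      ← Real.rpow_neg hn0.le, ← Real.rpow_add hn0]
    refine mul_le_mul_of_nonneg_right (Real.rpow_le_rpow_of_exponent_le hn ?_)
      (Real.rpow_nonneg (he n) _)
    have : α * (p - 1) = γ := div_mul_cancel₀ _ hp1.ne'
    nlinarith

/-- The truncation of the series defining `D1` and `D2` to the first `m` levels. -/
noncomputable def levelSum (p γ : ℝ) (M : ℕ → ℕ) (g : ℕ → ℕ → ℝ) (m : ℕ) : ℝ :=
  ∑ n ∈ Finset.range m, ((n : ℝ) + 1) ^ γ * ∑ l ∈ Finset.range (M (n + 1)), g n l ^ p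

theorem levelSum_nonneg (p γ : ℝ) (M : ℕ → ℕ) {g : ℕ → ℕ → ℝ} (hg : ∀ n l, 0 ≤ g n l) (m : ℕ) :
    0 ≤ levelSum p γ M g m :=
  Finset.sum_nonneg fun n _ => mul_nonneg (by positivity)
    (Finset.sum_nonneg fun l _ => Real.rpow_nonneg (hg n l) _)

theorem exists_sum_rpow_sum_stepVar_le {p γ : ℝ} (hp : 1 < p) (hγ : p - 1 < γ) (K : ℕ) {q : ℝ}
    (hq : 1 ≤ q) (hqp : q ≤ p) :
    ∃ c : ℝ, 0 ≤ c ∧ ∀ (η M : ℕ → ℕ), (∀ n, 0 < η n) → (∀ n, η n ≤ K) →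
      ∀ g : ℕ → ℕ → ℝ, (∀ n l, 0 ≤ g n l) → ∀ (N : ℕ) (φ : ℕ → ℕ → ℕ),
      (∀ n, MonotoneOn (fun i => φ i n) (Set.Iic N)) → (∀ i ≤ N, ∀ n, φ i n ≤ M n) → ∀ m,
      ∑ i ∈ Finset.range N, (∑ n ∈ Finset.range m, stepVar g η (φ i) (φ (i + 1)) n) ^ q ≤
        c * levelSum q γ M g m := by
  obtain ⟨W, hW, hWle⟩ := exists_rpow_sum_le hp hγ
  refine ⟨W ^ (q - 1) * multConst K q, mul_nonneg (Real.rpow_nonneg hW _) (multConst_nonneg K q),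
    ?_⟩
  intro η M hη hηK g hg N φ hφ hφM m
  calc _ ≤ ∑ i ∈ Finset.range N, W ^ (q - 1) * ∑ n ∈ Finset.range m, ((n : ℝ) + 1) ^ γ *
        stepVar g η (φ i) (φ (i + 1)) n ^ q :=
        Finset.sum_le_sum fun i _ => hWle q hq hqp _ (stepVar_nonneg hg _ _ _) m
    _ = W ^ (q - 1) * ∑ n ∈ Finset.range m, ((n : ℝ) + 1) ^ γ *
        ∑ i ∈ Finset.range N, stepVar g η (φ i) (φ (i + 1)) n ^ q := by
        rw [← Finset.mul_sum, Finset.sum_comm]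
        simp only [Finset.mul_sum]
    _ ≤ W ^ (q - 1) * ∑ n ∈ Finset.range m, ((n : ℝ) + 1) ^ γ *
        (multConst K q * ∑ l ∈ Finset.range (M (n + 1)), g n l ^ q) := by
        refine mul_le_mul_of_nonneg_left (Finset.sum_le_sum fun n _ => ?_)
          (Real.rpow_nonneg hW _)
        exact mul_le_mul_of_nonneg_left (sum_stepVar_rpow_le hη hηK hq hg hφ hφM n) (by positivity)
    _ = _ := by
        simp only [levelSum, Finset.mul_sum]
        refine Finset.sum_congr rfl fun n _ => Finset.sum_congr rfl fun l _ => ?_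
        ring

theorem exists_discrete_bound {p γ : ℝ} (hp : 2 ≤ p) (hγ : p - 1 < γ) (K : ℕ) :
    ∃ c : ℝ, 0 ≤ c ∧ ∀ (η M : ℕ → ℕ), (∀ n, 0 < η n) → (∀ n, η n ≤ K) →
      (∀ n, M (n + 1) = M n * η n) →
      ∀ {E F : Type} [NormedAddCommGroup E] [NormedAddCommGroup F] (w x y : ℝ → E)
        (C : ℝ → ℝ → F), AlmostAdditive w x y C → (∀ s, 0 ≤ s → s ≤ 1 → C s s = 0) →
      ∀ (N : ℕ) (φ : ℕ → ℕ → ℕ), (∀ n, MonotoneOn (fun i => φ i n) (Set.Iic N)) →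
      (∀ i ≤ N, ∀ n, φ i n ≤ M n) → (∀ i ≤ N, φ i 0 = 0) →
      (∀ i ≤ N, ∀ n, φ i n = φ i (n + 1) / η n) → ∀ m,
      ∑ i ∈ Finset.range N, ‖C ((φ i m : ℝ) / M m) ((φ (i + 1) m : ℝ) / M m)‖ ^ (p / 2) ≤
        c * (levelSum (p / 2) γ M (areaIncr M C) m +
          √(levelSum p γ M (pathIncr M w) m) *
            √(levelSum p γ M (pathIncr M x) m + levelSum p γ M (pathIncr M y) m)) := by
  obtain ⟨c₁, hc₁, h₁⟩ := exists_sum_rpow_sum_stepVar_le (by linarith) hγ K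
    (show 1 ≤ p / 2 by linarith) (by linarith)
  obtain ⟨c₂, hc₂, h₂⟩ := exists_sum_rpow_sum_stepVar_le (by linarith) hγ K
    (show 1 ≤ p by linarith) le_rfl
  refine ⟨2 ^ (p / 2 - 1) * (c₁ + 2 ^ (p / 2) * (√c₂ * √(2 ^ (p - 1) * c₂))), by positivity, ?_⟩
  intro η M hη hηK hM E F _ _ w x y C hC hC0 N φ hφ hφM hφ0 hφη m
  set e : (ℕ → ℕ → ℝ) → ℕ → ℝ :=
    fun g i => ∑ n ∈ Finset.range m, stepVar g η (φ i) (φ (i + 1)) n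
  have he0 {g : ℕ → ℕ → ℝ} (hg : ∀ n l, 0 ≤ g n l) (i : ℕ) : 0 ≤ e g i :=
    Finset.sum_nonneg fun n _ => stepVar_nonneg hg _ _ _ n
  have hpath0 (z : ℝ → E) (n l : ℕ) : 0 ≤ pathIncr M z n l := norm_nonneg _
  have harea0 (n l : ℕ) : 0 ≤ areaIncr M C n l := norm_nonneg _
  have hpath (z : ℝ → E) : ∑ i ∈ Finset.range N, e (pathIncr M z) i ^ p ≤
      c₂ * levelSum p γ M (pathIncr M z) m := h₂ η M hη hηK _ (hpath0 z) N φ hφ hφM m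
  have harea : ∑ i ∈ Finset.range N, e (areaIncr M C) i ^ (p / 2) ≤
      c₁ * levelSum (p / 2) γ M (areaIncr M C) m := h₁ η M hη hηK _ harea0 N φ hφ hφM m
  have hterm : ∀ i ∈ Finset.range N,
      ‖C ((φ i m : ℝ) / M m) ((φ (i + 1) m : ℝ) / M m)‖ ^ (p / 2) ≤
        2 ^ (p / 2 - 1) * (e (areaIncr M C) i ^ (p / 2) + 2 ^ (p / 2) *
          (e (pathIncr M w) i ^ (p / 2) *
            (e (pathIncr M x) i + e (pathIncr M y) i) ^ (p / 2))) := by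
    intro i hi
    have hi := Finset.mem_range.1 hi
    have hxy : 0 ≤ e (pathIncr M x) i + e (pathIncr M y) i :=
      add_nonneg (he0 (hpath0 x) i) (he0 (hpath0 y) i)
    have h := norm_area_le_stepVar hC hC0 hη hM (hφη i hi.le) (hφη (i + 1) hi)
      (fun n => hφ n (Set.mem_Iic.2 hi.le) (Set.mem_Iic.2 hi) i.le_succ) (hφM (i + 1) hi)
      (by rw [hφ0 i hi.le, hφ0 (i + 1) hi]) m
    refine (Real.rpow_le_rpow (norm_nonneg _) h (by linarith)).trans ?_
    rw [← Real.mul_rpow (he0 (hpath0 w) i) hxy,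
      ← Real.mul_rpow zero_le_two (mul_nonneg (he0 (hpath0 w) i) hxy)]
    exact add_rpow_le_two_rpow_mul (by linarith) (he0 harea0 i)
      (mul_nonneg zero_le_two (mul_nonneg (he0 (hpath0 w) i) hxy))
  have hsq {r : ℝ} (hr : 0 ≤ r) : (r ^ (p / 2)) ^ 2 = r ^ p := by
    rw [← Real.rpow_natCast, ← Real.rpow_mul hr]
    norm_num
  have hcross : ∑ i ∈ Finset.range N, e (pathIncr M w) i ^ (p / 2) *
        (e (pathIncr M x) i + e (pathIncr M y) i) ^ (p / 2) ≤
      (√c₂ * √(2 ^ (p - 1) * c₂)) * (√(levelSum p γ M (pathIncr M w) m) *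
        √(levelSum p γ M (pathIncr M x) m + levelSum p γ M (pathIncr M y) m)) := by
    refine (Real.sum_mul_le_sqrt_mul_sqrt _ _ _).trans ?_
    rw [mul_mul_mul_comm, ← Real.sqrt_mul hc₂,
      ← Real.sqrt_mul (mul_nonneg (Real.rpow_nonneg zero_le_two _) hc₂)]
    have hsum : ∀ i, (e (pathIncr M x) i + e (pathIncr M y) i) ^ p ≤
        2 ^ (p - 1) * (e (pathIncr M x) i ^ p + e (pathIncr M y) i ^ p) := fun i =>
      add_rpow_le_two_rpow_mul (by linarith) (he0 (hpath0 x) i) (he0 (hpath0 y) i)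
    refine mul_le_mul (Real.sqrt_le_sqrt ?_) (Real.sqrt_le_sqrt ?_) (Real.sqrt_nonneg _)
      (Real.sqrt_nonneg _)
    · simp only [hsq (he0 (hpath0 w) _)]
      exact hpath w
    · simp only [hsq (add_nonneg (he0 (hpath0 x) _) (he0 (hpath0 y) _))]
      refine (Finset.sum_le_sum fun i _ => hsum i).trans ?_
      rw [← Finset.mul_sum, Finset.sum_add_distrib, mul_assoc, mul_add c₂]
      exact mul_le_mul_of_nonneg_left (add_le_add (hpath x) (hpath y)) (by positivity)
  refine (Finset.sum_le_sum hterm).trans ?_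
  rw [← Finset.mul_sum, Finset.sum_add_distrib, ← Finset.mul_sum, mul_assoc]
  refine mul_le_mul_of_nonneg_left ?_ (by positivity)
  have hA := levelSum_nonneg (p / 2) γ M harea0 m
  set S := √(levelSum p γ M (pathIncr M w) m) *
    √(levelSum p γ M (pathIncr M x) m + levelSum p γ M (pathIncr M y) m)
  have hS : 0 ≤ S := by positivity
  have h2 : (0 : ℝ) ≤ 2 ^ (p / 2) := by positivity
  have hk : 0 ≤ √c₂ * √(2 ^ (p - 1) * c₂) := by positivity
  have hcross' := mul_le_mul_of_nonneg_left hcross h2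
  linarith [mul_nonneg hc₁ hS, mul_nonneg (mul_nonneg h2 hk) hA]

/-- The index `l` of the cell `(l / M n, (l + 1) / M n]` containing `s` (and `0` for `s = 0`). -/
noncomputable def cellIdx (M : ℕ → ℕ) (s : ℝ) (n : ℕ) : ℕ := ⌈s * M n⌉₊ - 1

theorem cellIdx_mono (M : ℕ → ℕ) (n : ℕ) : Monotone fun s => cellIdx M s n := fun s t hst =>
  Nat.sub_le_sub_right (Nat.ceil_mono (by gcongr)) 1

theorem cellIdx_le (M : ℕ → ℕ) {s : ℝ} (hs : s ≤ 1) (n : ℕ) : cellIdx M s n ≤ M n :=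
  (Nat.sub_le _ _).trans (Nat.ceil_le.2 (mul_le_of_le_one_left (by positivity) hs))

theorem cellIdx_zero {M : ℕ → ℕ} (hM : M 0 = 1) {s : ℝ} (hs : s ≤ 1) : cellIdx M s 0 = 0 :=
  Nat.sub_eq_zero_of_le (Nat.ceil_le.2 (by simpa [hM] using hs))

theorem cellIdx_eq_div {M : ℕ → ℕ} {s : ℝ} (n : ℕ) {e : ℕ} (he : 0 < e)
    (hM : M (n + 1) = M n * e) : cellIdx M s n = cellIdx M s (n + 1) / e := by
  have he' : (0 : ℝ) < e := by exact_mod_cast he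
  have hX : s * (M (n + 1) : ℝ) = s * M n * e := by rw [hM]; push_cast; ring
  unfold cellIdx
  rw [hX]
  generalize s * (M n : ℝ) = X
  rcases le_or_gt X 0 with h | h
  · rw [Nat.ceil_eq_zero.2 h, Nat.ceil_eq_zero.2 (mul_nonpos_of_nonpos_of_nonneg h he'.le)]
    simp
  · obtain ⟨k, hk⟩ := Nat.exists_eq_succ_of_ne_zero (Nat.ceil_pos.2 (mul_pos h he')).ne'
    obtain ⟨hk1, hk2⟩ := (Nat.ceil_eq_iff k.succ_ne_zero).1 hk
    have hdm := Nat.div_add_mod k e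
    have hlt := Nat.mod_lt k he
    have h1 : ((k / e : ℕ) : ℝ) * e ≤ k := by exact_mod_cast Nat.div_mul_le_self k e
    have h2 : ((k + 1 : ℕ) : ℝ) ≤ ((k / e + 1 : ℕ) : ℝ) * e := by
      have : k + 1 ≤ (k / e + 1) * e := by linarith
      exact_mod_cast this
    have hj : ⌈X⌉₊ = k / e + 1 := by
      refine (Nat.ceil_eq_iff (Nat.succ_ne_zero _)).2 ⟨?_, ?_⟩
      · refine lt_of_mul_lt_mul_right (h1.trans_lt ?_) he'.le
        simpa using hk1
      · exact le_of_mul_le_mul_right (hk2.trans h2) he'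
    rw [hj, hk]
    simp

theorem tendsto_cellIdx_div {M : ℕ → ℕ} (hM : Filter.Tendsto M Filter.atTop Filter.atTop)
    {s : ℝ} (hs : 0 ≤ s) :
    Filter.Tendsto (fun n => (cellIdx M s n : ℝ) / M n) Filter.atTop (nhds s) := by
  have hinv : Filter.Tendsto (fun n => s - ((M n : ℝ))⁻¹) Filter.atTop (nhds s) := by
    simpa using tendsto_const_nhds.sub
      (tendsto_inv_atTop_zero.comp ((tendsto_natCast_atTop_atTop (R := ℝ)).comp hM))
  refine tendsto_of_tendsto_of_tendsto_of_le_of_le' hinv tendsto_const_nhds ?_ ?_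
  · filter_upwards [hM.eventually_ge_atTop 1] with n hn
    have hn' : (0 : ℝ) < M n := by exact_mod_cast hn
    rw [le_div_iff₀ hn', sub_mul, inv_mul_cancel₀ hn'.ne']
    have h1 := Nat.le_ceil (s * (M n : ℝ))
    have h2 : (⌈s * (M n : ℝ)⌉₊ : ℝ) ≤ cellIdx M s n + 1 := by
      have : ⌈s * (M n : ℝ)⌉₊ ≤ cellIdx M s n + 1 := by unfold cellIdx; omega
      exact_mod_cast this
    linarith
  · filter_upwards [hM.eventually_ge_atTop 1] with n hn
    have hn' : (0 : ℝ) < M n := by exact_mod_cast hn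
    rw [div_le_iff₀ hn', cellIdx]
    rcases Nat.eq_zero_or_pos ⌈s * (M n : ℝ)⌉₊ with h | h
    · rw [h]
      simpa using mul_nonneg hs hn'.le
    · exact (Nat.lt_ceil.1 (Nat.sub_lt h one_pos)).le

theorem ofReal_levelSum_le_tsum (p γ : ℝ) (M : ℕ → ℕ) {g : ℕ → ℕ → ℝ} (hg : ∀ n l, 0 ≤ g n l)
    (m : ℕ) :
    ENNReal.ofReal (levelSum p γ M g m) ≤
      ∑' n : ℕ, ENNReal.ofReal (((n : ℝ) + 1) ^ γ) *
        ∑ l ∈ Finset.range (M (n + 1)), ENNReal.ofReal (g n l ^ p) := by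
  have hgp (n l : ℕ) : 0 ≤ g n l ^ p := Real.rpow_nonneg (hg n l) p
  rw [levelSum, ENNReal.ofReal_sum_of_nonneg fun n _ =>
    mul_nonneg (by positivity) (Finset.sum_nonneg fun l _ => hgp n l)]
  refine le_trans (le_of_eq (Finset.sum_congr rfl fun n _ => ?_)) (ENNReal.sum_le_tsum _)
  rw [ENNReal.ofReal_mul (by positivity), ENNReal.ofReal_sum_of_nonneg fun l _ => hgp n l]

theorem ofReal_levelSum_le_D1 {p : ℝ} (hp : p ≠ 0) (γ : ℝ) (M : ℕ → ℕ) {d : ℕ}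
    (z : ℝ → EuclideanSpace ℝ (Fin d)) (m : ℕ) :
    ENNReal.ofReal (levelSum p γ M (pathIncr M z) m) ≤ D1 p γ M z ^ p := by
  rw [D1, ← ENNReal.rpow_mul, one_div_mul_cancel hp, ENNReal.rpow_one]
  exact ofReal_levelSum_le_tsum p γ M (fun _ _ => norm_nonneg _) m

theorem ofReal_levelSum_le_D2 {p : ℝ} (hp : p ≠ 0) (γ : ℝ) (M : ℕ → ℕ) {d : ℕ}
    (C : ℝ → ℝ → EuclideanSpace ℝ (Fin d × Fin d)) (m : ℕ) :
    ENNReal.ofReal (levelSum (p / 2) γ M (areaIncr M C) m) ≤ D2 p γ M C ^ (p / 2) := by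
  rw [D2, ← ENNReal.rpow_mul, div_mul_div_cancel₀ hp, div_self two_ne_zero, ENNReal.rpow_one]
  exact ofReal_levelSum_le_tsum (p / 2) γ M (fun _ _ => norm_nonneg _) m

theorem almostAdditive_sub_of_chen {d : ℕ} {x y : ℝ → EuclideanSpace ℝ (Fin d)}
    {A B : ℝ → ℝ → EuclideanSpace ℝ (Fin d × Fin d)}
    (hA : ∀ s u t : ℝ, 0 ≤ s → s ≤ u → u ≤ t → t ≤ 1 →
      A s t = A s u + A u t + outer (x u - x s) (x t - x u))
    (hB : ∀ s u t : ℝ, 0 ≤ s → s ≤ u → u ≤ t → t ≤ 1 →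
      B s t = B s u + B u t + outer (y u - y s) (y t - y u)) :
    AlmostAdditive (x - y) x y fun s t => A s t - B s t := by
  intro s u t hs hsu hut ht
  have h : A s t - B s t - (A s u - B s u) - (A u t - B u t) =
      outer ((x - y) u - (x - y) s) (x t - x u) + outer (y u - y s) ((x - y) t - (x - y) u) := by
    rw [hA s u t hs hsu hut ht, hB s u t hs hsu hut ht, Pi.sub_apply, Pi.sub_apply, Pi.sub_apply,
      sub_sub_sub_comm (x u), sub_sub_sub_comm (x t), ← outer_sub_outer]
    abel
  rw [h]
  exact (norm_add_le _ _).trans (by rw [norm_outer, norm_outer])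

/-- Second-level variation estimate: for `p ≥ 2`, `γ > p − 1`, `K ≥ 2`, there is a
constant `c = c(K, p, γ)` such that for any admissible sequence `(η_i)`, continuous
paths `x, y`, and continuous two-parameter functions `A, B` vanishing on the diagonal
and satisfying Chen's identity with respect to `x` resp. `y`, every
`p/2`-variation sum of `A − B` is at most
`c [ D₂(A−B)^{p/2} + D₁(x−y)^{p/2} (D₁(x)^p + D₁(y)^p)^{1/2} ]`. -/
theorem second_level_variation_bound
    (p γ : ℝ) (hp : 2 ≤ p) (hγ : p - 1 < γ) (K : ℕ) (hK : 2 ≤ K) :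
    ∃ c : ℝ, ∀ η : ℕ → ℕ, (∀ i, 2 ≤ η i ∧ η i ≤ K) →
      ∀ (d : ℕ) (x y : ℝ → EuclideanSpace ℝ (Fin d))
        (A B : ℝ → ℝ → EuclideanSpace ℝ (Fin d × Fin d)),
        ContinuousOn x (Icc 0 1) → ContinuousOn y (Icc 0 1) →
        ContinuousOn (fun q : ℝ × ℝ => A q.1 q.2)
          {q : ℝ × ℝ | 0 ≤ q.1 ∧ q.1 ≤ q.2 ∧ q.2 ≤ 1} →
        ContinuousOn (fun q : ℝ × ℝ => B q.1 q.2)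
          {q : ℝ × ℝ | 0 ≤ q.1 ∧ q.1 ≤ q.2 ∧ q.2 ≤ 1} →
        (∀ s : ℝ, 0 ≤ s → s ≤ 1 → A s s = 0) →
        (∀ s : ℝ, 0 ≤ s → s ≤ 1 → B s s = 0) →
        (∀ s u t : ℝ, 0 ≤ s → s ≤ u → u ≤ t → t ≤ 1 →
          A s t = A s u + A u t + outer (x u - x s) (x t - x u)) →
        (∀ s u t : ℝ, 0 ≤ s → s ≤ u → u ≤ t → t ≤ 1 →
          B s t = B s u + B u t + outer (y u - y s) (y t - y u)) →
        ∀ (N : ℕ) (t : ℕ → ℝ), t 0 = 0 → t N = 1 → (∀ i < N, t i < t (i + 1)) →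
          ENNReal.ofReal
              (∑ i ∈ Finset.range N, ‖A (t i) (t (i + 1)) - B (t i) (t (i + 1))‖ ^ (p / 2)) ≤
            ENNReal.ofReal c *
              (D2 p γ (fun n => ∏ i ∈ Finset.range n, η i)
                  (fun s t => A s t - B s t) ^ (p / 2) +
                D1 p γ (fun n => ∏ i ∈ Finset.range n, η i) (x - y) ^ (p / 2) *
                  (D1 p γ (fun n => ∏ i ∈ Finset.range n, η i) x ^ p +
                    D1 p γ (fun n => ∏ i ∈ Finset.range n, η i) y ^ p) ^ ((1 : ℝ) / 2)) := by
  obtain ⟨c, hc, hbound⟩ := exists_discrete_bound hp hγ K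
  refine ⟨c, ?_⟩
  intro η hη d x y A B _ _ hAc hBc hA0 hB0 hA hB N t ht0 htN ht
  set M : ℕ → ℕ := fun n => ∏ i ∈ Finset.range n, η i
  have hM (n : ℕ) : M (n + 1) = M n * η n := Finset.prod_range_succ _ _
  have hM0 : M 0 = 1 := Finset.prod_range_zero _
  have hηpos (n : ℕ) : 0 < η n := two_pos.trans_le (hη n).1
  have hMtop : Filter.Tendsto M Filter.atTop Filter.atTop := by
    have hpow (n : ℕ) : 2 ^ n ≤ M n := by
      simpa using Finset.prod_le_prod' (s := Finset.range n) fun i _ => (hη i).1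
    exact Filter.tendsto_atTop_mono hpow (tendsto_pow_atTop_atTop_of_one_lt one_lt_two)
  have htmono : MonotoneOn t (Set.Iic N) := by
    refine monotoneOn_of_le_succ Set.ordConnected_Iic fun i _ _ hi => ?_
    exact (ht i (Nat.lt_of_succ_le hi)).le
  have ht_nonneg {i : ℕ} (hi : i ≤ N) : 0 ≤ t i :=
    ht0 ▸ htmono (Set.mem_Iic.2 N.zero_le) (Set.mem_Iic.2 hi) i.zero_le
  have ht_le {i : ℕ} (hi : i ≤ N) : t i ≤ 1 :=
    htN ▸ htmono (Set.mem_Iic.2 hi) (Set.mem_Iic.2 le_rfl) hi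
  set C : ℝ → ℝ → EuclideanSpace ℝ (Fin d × Fin d) := fun s t => A s t - B s t with hCdef
  have hC0 (s : ℝ) (h0 : 0 ≤ s) (h1 : s ≤ 1) : C s s = 0 := by
    simp [hCdef, hA0 s h0 h1, hB0 s h0 h1]
  set φ : ℕ → ℕ → ℕ := fun i => cellIdx M (t i)
  have hφmono (n : ℕ) : MonotoneOn (fun i => φ i n) (Set.Iic N) :=
    fun i hi j hj hij => cellIdx_mono M n (htmono hi hj hij)
  have hφM : ∀ i ≤ N, ∀ n, φ i n ≤ M n := fun i hi n => cellIdx_le M (ht_le hi) n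
  have hlim : ∀ i ∈ Finset.range N, Filter.Tendsto
      (fun m => ‖C ((φ i m : ℝ) / M m) ((φ (i + 1) m : ℝ) / M m)‖ ^ (p / 2)) Filter.atTop
      (nhds (‖C (t i) (t (i + 1))‖ ^ (p / 2))) := by
    intro i hi
    have hi := Finset.mem_range.1 hi
    have hcont := (hAc.sub hBc) (t i, t (i + 1)) ⟨ht_nonneg hi.le, (ht i hi).le, ht_le hi⟩
    have hpts : Filter.Tendsto
        (fun m => (((φ i m : ℝ) / M m, (φ (i + 1) m : ℝ) / M m) : ℝ × ℝ)) Filter.atTop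
        (nhdsWithin (t i, t (i + 1)) {q : ℝ × ℝ | 0 ≤ q.1 ∧ q.1 ≤ q.2 ∧ q.2 ≤ 1}) := by
      refine tendsto_nhdsWithin_iff.2 ⟨?_, Filter.Eventually.of_forall fun m => ⟨?_, ?_, ?_⟩⟩
      · exact (tendsto_cellIdx_div hMtop (ht_nonneg hi.le)).prodMk_nhds
          (tendsto_cellIdx_div hMtop (ht_nonneg hi))
      · positivity
      · have := hφmono m (Set.mem_Iic.2 hi.le) (Set.mem_Iic.2 hi) i.le_succ
        dsimp only at this ⊢
        gcongr
      · exact div_le_one_of_le₀ (by exact_mod_cast hφM (i + 1) hi m) (by positivity)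
    exact ((hcont.tendsto.comp hpts).norm).rpow_const (Or.inr (by linarith))
  refine le_of_tendsto' (ENNReal.tendsto_ofReal (tendsto_finsetSum _ hlim)) fun m => ?_
  have h := hbound η M hηpos (fun n => (hη n).2) hM (x - y) x y C
    (almostAdditive_sub_of_chen hA hB) hC0 N φ hφmono hφM
    (fun i hi => cellIdx_zero hM0 (ht_le hi))
    (fun i _ n => cellIdx_eq_div n (hηpos n) (hM n)) m
  refine (ENNReal.ofReal_le_ofReal h).trans ?_
  have hp0 : p ≠ 0 := by linarith
  have hlevel (z : ℝ → EuclideanSpace ℝ (Fin d)) : 0 ≤ levelSum p γ M (pathIncr M z) m :=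
    levelSum_nonneg p γ M (fun _ _ => norm_nonneg _) m
  have hsqrt {r : ℝ} (hr : 0 ≤ r) : ENNReal.ofReal √r = ENNReal.ofReal r ^ ((1 : ℝ) / 2) := by
    rw [Real.sqrt_eq_rpow, ENNReal.ofReal_rpow_of_nonneg hr (by norm_num)]
  have hhalf : D1 p γ M (x - y) ^ (p / 2) = (D1 p γ M (x - y) ^ p) ^ ((1 : ℝ) / 2) := by
    rw [← ENNReal.rpow_mul, mul_one_div]
  rw [ENNReal.ofReal_mul hc, ENNReal.ofReal_add
    (levelSum_nonneg _ _ _ (g := areaIncr M C) (fun _ _ => norm_nonneg _) m) (by positivity),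
    ENNReal.ofReal_mul (Real.sqrt_nonneg _), hsqrt (hlevel _),
    hsqrt (add_nonneg (hlevel x) (hlevel y)), ENNReal.ofReal_add (hlevel x) (hlevel y), hhalf]
  gcongr
  · exact ofReal_levelSum_le_D2 hp0 γ M C m
  · exact ofReal_levelSum_le_D1 hp0 γ M (x - y) m
  · exact ofReal_levelSum_le_D1 hp0 γ M x m
  · exact ofReal_levelSum_le_D1 hp0 γ M y m
end

section
/- Let p ≥ 1 and δ ∈ (0,1) with δ − 1/p > 0. For each integer m ≥ 1 consider the function f_m : [0,1] → ℝ defined by f_m(t) = (1 + m²)^{−δ/2} √2 cos(mπt). Then its p-variation norm satisfies the exact identity |f_m(0)| + ( sup over all finite partitions 0 = t_0 < ⋯ < t_N = 1 of Σ_{i=1}^N |f_m(t_i) − f_m(t_{i−1})|^p )^{1/p} = (1 + m²)^{−δ/2} √2 (1 + 2 m^{1/p}), and consequently there is a constant c depending only on δ and p such that this p-variation norm is at most c (1 + m)^{−(δ − 1/p)} for every m ≥ 1. -/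
open Set Finset
open scoped Real

/-- The total variation of `cos` along an increasing chain is bounded by the integral of `|sin|`. -/
theorem sum_abs_cos_sub_cos_le (θ : ℕ → ℝ) (N : ℕ) (hθ : ∀ i < N, θ i ≤ θ (i + 1)) :
    ∑ i ∈ Finset.range N, |Real.cos (θ (i + 1)) - Real.cos (θ i)| ≤
      ∫ x in θ 0..θ N, |Real.sin x| := by
  have hint (a b : ℝ) : IntervalIntegrable (fun x => |Real.sin x|) MeasureTheory.volume a b :=
    (Real.continuous_sin.abs).intervalIntegrable a b
  rw [← intervalIntegral.sum_integral_adjacent_intervals (fun k _ => hint (θ k) (θ (k + 1)))]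
  refine Finset.sum_le_sum fun i hi => ?_
  have hle := hθ i (Finset.mem_range.mp hi)
  calc |Real.cos (θ (i + 1)) - Real.cos (θ i)|
      = |∫ x in θ i..θ (i + 1), Real.sin x| := by rw [integral_sin, abs_sub_comm]
    _ ≤ ∫ x in θ i..θ (i + 1), |Real.sin x| := intervalIntegral.abs_integral_le_integral_abs hle

theorem integral_abs_sin_zero_nat_mul_pi (m : ℕ) :
    ∫ x in (0 : ℝ)..m * Real.pi, |Real.sin x| = 2 * m := by
  have hper : Function.Periodic (fun x => |Real.sin x|) Real.pi := fun x => by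
    simp [Real.sin_add_pi]
  have hπ : ∫ x in (0 : ℝ)..Real.pi, |Real.sin x| = 2 := by
    rw [intervalIntegral.integral_congr (g := Real.sin), integral_sin]
    · norm_num
    · intro x hx
      rw [Set.uIcc_of_le Real.pi_pos.le] at hx
      exact abs_of_nonneg (Real.sin_nonneg_of_mem_Icc hx)
  have key := hper.intervalIntegral_add_zsmul_eq (m : ℤ) 0
    (fun a b => (Real.continuous_sin.abs).intervalIntegrable a b)
  simp only [zero_add, hπ, natCast_zsmul, nsmul_eq_mul] at key
  rw [key, mul_comm]

/-- For `0 ≤ x ≤ 2` and `p ≥ 1` one has `x ^ p ≤ 2 ^ p * (x / 2)`; stated with a scaling factor. -/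
theorem mul_rpow_le_of_le_two {A x p : ℝ} (hA : 0 ≤ A) (hx : 0 ≤ x) (hx2 : x ≤ 2) (hp : 1 ≤ p) :
    (A * x) ^ p ≤ (2 * A) ^ p * (x / 2) := by
  rw [show A * x = (2 * A) * (x / 2) by ring, Real.mul_rpow (by positivity) (by positivity)]
  gcongr
  simpa using Real.rpow_le_rpow_of_exponent_ge_of_imp (x := x / 2) (y := p) (z := 1)
    (by positivity) (by linarith) hp (fun _ h => absurd h (by linarith))

/-- The `p`-variation sums of `A cos(mπt)` have the greatest element `m (2A)^p`. -/
theorem isGreatest_varSums_mul_cos {p A : ℝ} (hp : 1 ≤ p) (hA : 0 ≤ A) {m : ℕ} (hm : 1 ≤ m) :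
    IsGreatest (varSums p (fun t => A * Real.cos ((m : ℝ) * Real.pi * t))) (m * (2 * A) ^ p) := by
  have hm0 : (0 : ℝ) < m := by exact_mod_cast hm
  have hdiff (a b : ℝ) : ‖A * Real.cos a - A * Real.cos b‖ = A * |Real.cos a - Real.cos b| := by
    rw [← mul_sub, Real.norm_eq_abs, abs_mul, abs_of_nonneg hA]
  constructor
  · refine ⟨m, fun i => i / m, by simp, div_self hm0.ne', fun i _ => ?_, ?_⟩
    · exact div_lt_div_of_pos_right (by simp) hm0
    · rw [Finset.sum_congr rfl (g := fun _ => (2 * A) ^ p), Finset.sum_const, Finset.card_range,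
        nsmul_eq_mul]
      intro i _
      have h1 : (m : ℝ) * Real.pi * (((i + 1 : ℕ) : ℝ) / m) = i * Real.pi + Real.pi := by
        push_cast
        field_simp
      have h2 : (m : ℝ) * Real.pi * ((i : ℝ) / m) = i * Real.pi := by field_simp
      rw [hdiff, h1, h2, Real.cos_add_pi, Real.cos_nat_mul_pi]
      congr 1
      rw [show -(-1 : ℝ) ^ i - (-1) ^ i = -2 * (-1) ^ i by ring, abs_mul, abs_neg_one_pow]
      norm_num
      ring
  · rintro S ⟨N, t, h0, h1, ht, rfl⟩
    have hsum := sum_abs_cos_sub_cos_le (fun i => (m : ℝ) * Real.pi * t i) N fun i hi =>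
      mul_le_mul_of_nonneg_left (ht i hi).le (by positivity)
    simp only [h0, h1, mul_zero, mul_one, integral_abs_sin_zero_nat_mul_pi] at hsum
    calc _ ≤ ∑ i ∈ Finset.range N, (2 * A) ^ p *
          (|Real.cos (m * Real.pi * t (i + 1)) - Real.cos (m * Real.pi * t i)| / 2) := by
          refine Finset.sum_le_sum fun i _ => ?_
          rw [hdiff]
          refine mul_rpow_le_of_le_two hA (abs_nonneg _) ?_ hp
          rw [abs_le]
          constructor <;>
            linarith [Real.cos_le_one (m * Real.pi * t (i + 1)),
              Real.neg_one_le_cos (m * Real.pi * t (i + 1)),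
              Real.cos_le_one (m * Real.pi * t i), Real.neg_one_le_cos (m * Real.pi * t i)]
      _ ≤ (2 * A) ^ p * m := by
          rw [← Finset.mul_sum, ← Finset.sum_div]
          gcongr
          linarith
      _ = m * (2 * A) ^ p := mul_comm _ _

theorem abs_add_rpow_eq_mul_one_add {p A : ℝ} (hp : 1 ≤ p) (hA : 0 ≤ A) (m : ℕ) :
    |A * Real.cos ((m : ℝ) * Real.pi * 0)| + (m * (2 * A) ^ p) ^ (1 / p) =
      A * (1 + 2 * (m : ℝ) ^ (1 / p)) := by
  rw [mul_zero, Real.cos_zero, mul_one, abs_of_nonneg hA,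
    Real.mul_rpow (by positivity) (by positivity), ← Real.rpow_mul (by positivity),
    mul_one_div_cancel (by linarith), Real.rpow_one]
  ring

theorem one_add_sq_rpow_le {δ x : ℝ} (hδ : 0 ≤ δ) (hx : 0 ≤ x) :
    (1 + x ^ 2) ^ (-(δ / 2)) ≤ 2 ^ (δ / 2) * (1 + x) ^ (-δ) := by
  calc (1 + x ^ 2) ^ (-(δ / 2)) ≤ ((1 + x) ^ 2 / 2) ^ (-(δ / 2)) :=
        Real.rpow_le_rpow_of_nonpos (by positivity) (by nlinarith [sq_nonneg (1 - x)])
          (by linarith)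
    _ = 2 ^ (δ / 2) * (1 + x) ^ (-δ) := by
        rw [Real.div_rpow (by positivity) (by positivity), Real.rpow_neg zero_le_two, div_inv_eq_mul,
          ← Real.rpow_natCast, ← Real.rpow_mul (by positivity), mul_comm]
        congr 2
        push_cast
        ring

theorem one_add_two_mul_rpow_le {q x : ℝ} (hq : 0 ≤ q) (hx : 0 ≤ x) :
    1 + 2 * x ^ q ≤ 3 * (1 + x) ^ q := by
  have h1 : 1 ≤ (1 + x) ^ q := Real.one_le_rpow (by linarith) hq
  have h2 : x ^ q ≤ (1 + x) ^ q := Real.rpow_le_rpow hx (by linarith) hq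
  linarith

/-- For `p ≥ 1`, `δ ∈ (0,1)` with `δ − 1/p > 0`, the functions
`f_m(t) = (1 + m²)^{−δ/2} √2 cos(mπt)` (`m ≥ 1`) have `p`-variation norm exactly
`(1 + m²)^{−δ/2} √2 (1 + 2 m^{1/p})`, and consequently there is a constant
`c = c(δ, p)` such that this norm is at most `c (1 + m)^{−(δ − 1/p)}` for all `m ≥ 1`. -/
theorem cosine_basis_p_variation (p δ : ℝ) (hp : 1 ≤ p) (hδ : δ ∈ Ioo (0 : ℝ) 1)
    (h : 0 < δ - 1 / p) :
    (∀ m : ℕ, 1 ≤ m → ∃ S : ℝ,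
      IsLUB (varSums p
        (fun t => (1 + (m : ℝ) ^ 2) ^ (-(δ / 2)) * Real.sqrt 2 *
          Real.cos ((m : ℝ) * Real.pi * t))) S ∧
      |(1 + (m : ℝ) ^ 2) ^ (-(δ / 2)) * Real.sqrt 2 *
          Real.cos ((m : ℝ) * Real.pi * 0)| + S ^ (1 / p) =
        (1 + (m : ℝ) ^ 2) ^ (-(δ / 2)) * Real.sqrt 2 * (1 + 2 * (m : ℝ) ^ (1 / p))) ∧
    ∃ c : ℝ, ∀ m : ℕ, 1 ≤ m → ∀ S : ℝ,
      IsLUB (varSums p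
        (fun t => (1 + (m : ℝ) ^ 2) ^ (-(δ / 2)) * Real.sqrt 2 *
          Real.cos ((m : ℝ) * Real.pi * t))) S →
      |(1 + (m : ℝ) ^ 2) ^ (-(δ / 2)) * Real.sqrt 2 *
          Real.cos ((m : ℝ) * Real.pi * 0)| + S ^ (1 / p) ≤
        c * (1 + (m : ℝ)) ^ (-(δ - 1 / p)) := by
  have hA (m : ℕ) : 0 ≤ (1 + (m : ℝ) ^ 2) ^ (-(δ / 2)) * Real.sqrt 2 := by positivity
  refine ⟨fun m hm => ⟨_, (isGreatest_varSums_mul_cos hp (hA m) hm).isLUB,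
    abs_add_rpow_eq_mul_one_add hp (hA m) m⟩,
    2 ^ (δ / 2) * Real.sqrt 2 * 3, fun m hm S hS => ?_⟩
  rw [hS.unique (isGreatest_varSums_mul_cos hp (hA m) hm).isLUB,
    abs_add_rpow_eq_mul_one_add hp (hA m) m]
  have hm0 : (0 : ℝ) ≤ m := m.cast_nonneg
  calc _ ≤ 2 ^ (δ / 2) * (1 + (m : ℝ)) ^ (-δ) * Real.sqrt 2 * (3 * (1 + (m : ℝ)) ^ (1 / p)) := by
        gcongr
        · exact one_add_sq_rpow_le hδ.1.le hm0
        · exact one_add_two_mul_rpow_le (by positivity) hm0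
    _ = 2 ^ (δ / 2) * Real.sqrt 2 * 3 * (1 + (m : ℝ)) ^ (-(δ - 1 / p)) := by
        rw [show -(δ - 1 / p) = -δ + 1 / p by ring, Real.rpow_add (by positivity)]
        ring
end

section
/- Let p, q ≥ 1 with 1/p + 1/q > 1. Let ω be a continuous control function on the simplex {(s,t) : 0 ≤ s ≤ t ≤ 1}, i.e. ω is nonnegative, continuous, vanishes on the diagonal, and satisfies ω(s,u) + ω(u,t) ≤ ω(s,t) for s ≤ u ≤ t. Let k : [0,1] → L(ℝ^d, ℝ^n) (matrix-valued) and l : [0,1] → ℝ^d satisfy ‖k(t) − k(s)‖ ≤ ω(s,t)^{1/q} and |l(t) − l(s)| ≤ ω(s,t)^{1/p} for all 0 ≤ s ≤ t ≤ 1. Then there exist a constant C, depending only on p and q, and a function I : {(s,t) : 0 ≤ s ≤ t ≤ 1} → ℝ^n such that: (a) for every 0 ≤ s ≤ t ≤ 1 and every ε > 0 there is η > 0 such that for every partition s = t_0 < t_1 < ⋯ < t_N = t of [s,t] with max_i (t_i − t_{i−1}) < η, one has |Σ_{i=1}^N k(t_{i−1}) (l(t_i) − l(t_{i−1})) − I(s,t)|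 < ε (so I(s,t) is the Young integral ∫_s^t k dl); and (b) |I(s,t) − k(s)(l(t) − l(s))| ≤ C · ω(s,t)^{1/p + 1/q} for all 0 ≤ s ≤ t ≤ 1. -/
open Set Finset

open Filter Topology

/-- Discrete sewing estimate: an almost additive function of pairs of indices is close to the
sum of its increments, uniformly in the number of summands. -/
lemma norm_sum_sub_le_of_almost_additive {E : Type*} [NormedAddCommGroup E] {θ K : ℝ}
    (hθ : 1 < θ) (hK : 2 + 2 ^ (1 - θ) * K = K) (hK0 : 0 ≤ K) {M : ℕ} {w : ℕ → ℕ → ℝ}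
    {a : ℕ → ℕ → E} (hw0 : ∀ i j, i ≤ j → j ≤ M → 0 ≤ w i j) (hwd : ∀ i, i ≤ M → w i i = 0)
    (hws : ∀ i j m, i ≤ j → j ≤ m → m ≤ M → w i j + w j m ≤ w i m)
    (ha : ∀ i j m, i ≤ j → j ≤ m → m ≤ M → ‖a i m - a i j - a j m‖ ≤ w i m ^ θ) :
    ∀ N i j, j - i ≤ N → i ≤ j → j ≤ M →
      ‖∑ m ∈ Finset.Ico i j, a m (m + 1) - a i j‖ ≤ K * w i j ^ θ := by
  have diag : ∀ i, i ≤ M → a i i = 0 := by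
    intro i hi
    have h := ha i i i le_rfl le_rfl hi
    rw [hwd i hi, Real.zero_rpow (by linarith)] at h
    simpa using h
  intro N
  induction N with
  | zero =>
    intro i j hN hij hj
    obtain rfl : i = j := by omega
    simp [diag i hj, hwd i hj, Real.zero_rpow (show θ ≠ 0 by linarith)]
  | succ N ih =>
    intro i j hN hij hj
    rcases hij.eq_or_lt with rfl | hlt
    · simp [diag i hj, hwd i hj, Real.zero_rpow (show θ ≠ 0 by linarith)]
    have hw := hw0 i j hij hj
    obtain ⟨c, hic, hcj, hc1, hc2⟩ : ∃ c, i ≤ c ∧ c < j ∧ w i c ≤ w i j / 2 ∧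
        w (c + 1) j ≤ w i j / 2 := by
      classical
      have hi0 : w i i ≤ w i j / 2 := by rw [hwd i (by omega)]; linarith
      let P : ℕ → Prop := fun c => i ≤ c ∧ w i c ≤ w i j / 2
      have hPi : P i := ⟨le_rfl, hi0⟩
      have hs : P (Nat.findGreatest P (j - 1)) :=
        Nat.findGreatest_spec (P := P) (show i ≤ j - 1 by omega) hPi
      have hle := Nat.findGreatest_le (P := P) (j - 1)
      have hgt := fun m => Nat.findGreatest_is_greatest (P := P) (n := j - 1) (k := m)
      generalize Nat.findGreatest P (j - 1) = c at hs hle hgt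
      refine ⟨c, hs.1, by omega, hs.2, ?_⟩
      rcases (show c + 1 ≤ j by omega).eq_or_lt with h | h
      · rw [h, hwd j hj]; linarith
      · have h1 : ¬ P (c + 1) := hgt (c + 1) (by omega) (by omega)
        have h2 : w i j / 2 < w i (c + 1) := by
          by_contra h3
          exact h1 ⟨by have := hs.1; omega, not_lt.mp h3⟩
        have := hws i (c + 1) j (by have := hs.1; omega) h.le hj
        linarith
    have e1 := ih i c (by omega) hic (by omega)
    have e2 := ih (c + 1) j (by omega) (by omega) hj
    have e3 := ha i c j hic hcj.le hj
    have e4 := ha c (c + 1) j (by omega) (by omega) hj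
    have half : ∀ x, 0 ≤ x → x ≤ w i j / 2 → 2 * x ^ θ ≤ 2 ^ (1 - θ) * w i j ^ θ := by
      intro x hx hx2
      have := Real.rpow_le_rpow hx hx2 (by linarith : (0 : ℝ) ≤ θ)
      rw [Real.div_rpow hw (by norm_num)] at this
      rw [Real.rpow_sub (by norm_num), Real.rpow_one]
      calc 2 * x ^ θ ≤ 2 * (w i j ^ θ / 2 ^ θ) := by linarith
        _ = _ := by ring
    have h1 := half _ (hw0 i c hic (by omega)) hc1
    have h2 := half _ (hw0 (c + 1) j (by omega) hj) hc2
    have h3 : w c j ^ θ ≤ w i j ^ θ := by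
      refine Real.rpow_le_rpow (hw0 c j hcj.le hj) ?_ (by linarith)
      have := hws i c j hic hcj.le hj
      have := hw0 i c hic (by omega)
      linarith
    have hsplit : ∑ m ∈ Finset.Ico i j, a m (m + 1) - a i j =
        (∑ m ∈ Finset.Ico i c, a m (m + 1) - a i c)
        + (∑ m ∈ Finset.Ico (c + 1) j, a m (m + 1) - a (c + 1) j)
        - (a i j - a i c - a c j) - (a c j - a c (c + 1) - a (c + 1) j) := by
      rw [← Finset.sum_Ico_consecutive _ hic hcj.le, Finset.sum_eq_sum_Ico_succ_bot hcj]
      abel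
    rw [hsplit]
    refine (norm_sub_le _ _).trans ?_
    have n1 := norm_sub_le ((∑ m ∈ Finset.Ico i c, a m (m + 1) - a i c)
        + (∑ m ∈ Finset.Ico (c + 1) j, a m (m + 1) - a (c + 1) j)) (a i j - a i c - a c j)
    have n2 := norm_add_le (∑ m ∈ Finset.Ico i c, a m (m + 1) - a i c)
        (∑ m ∈ Finset.Ico (c + 1) j, a m (m + 1) - a (c + 1) j)
    have h4 : 2 * (K * w i c ^ θ) ≤ K * (2 ^ (1 - θ) * w i j ^ θ) := by
      have := mul_le_mul_of_nonneg_left h1 hK0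
      linarith
    have h5 : 2 * (K * w (c + 1) j ^ θ) ≤ K * (2 ^ (1 - θ) * w i j ^ θ) := by
      have := mul_le_mul_of_nonneg_left h2 hK0
      linarith
    have h6 : K * w i j ^ θ = 2 * w i j ^ θ + K * (2 ^ (1 - θ) * w i j ^ θ) := by
      linear_combination (-(w i j ^ θ)) * hK
    linarith

/-- A control that is continuous on the closed simplex is uniformly small near the diagonal. -/
lemma exists_control_lt_near_diagonal {ω : ℝ → ℝ → ℝ}
    (hc : ContinuousOn (fun z : ℝ × ℝ => ω z.1 z.2)
      {z : ℝ × ℝ | 0 ≤ z.1 ∧ z.1 ≤ z.2 ∧ z.2 ≤ 1})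
    (hd : ∀ s : ℝ, 0 ≤ s → s ≤ 1 → ω s s = 0) {δ : ℝ} (hδ : 0 < δ) :
    ∃ η : ℝ, 0 < η ∧ ∀ s t, 0 ≤ s → s ≤ t → t ≤ 1 → t - s < η → ω s t < δ := by
  have hcomp : IsCompact {z : ℝ × ℝ | 0 ≤ z.1 ∧ z.1 ≤ z.2 ∧ z.2 ≤ 1} := by
    refine (isCompact_Icc (a := ((0, 0) : ℝ × ℝ)) (b := (1, 1))).of_isClosed_subset ?_ ?_
    · exact (isClosed_le continuous_const continuous_fst).inter
        ((isClosed_le continuous_fst continuous_snd).inter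
          (isClosed_le continuous_snd continuous_const))
    · rintro ⟨x, y⟩ ⟨h1, h2, h3⟩
      simp only at h1 h2 h3
      exact ⟨⟨h1, h1.trans h2⟩, ⟨h2.trans h3, h3⟩⟩
  have hu := hcomp.uniformContinuousOn_of_continuous hc
  rw [Metric.uniformContinuousOn_iff] at hu
  obtain ⟨η, hη, h⟩ := hu δ hδ
  refine ⟨η, hη, fun s t hs hst ht hlt => ?_⟩
  have := h (s, t) ⟨hs, hst, ht⟩ (s, s) ⟨hs, le_rfl, hst.trans ht⟩ (by
    rw [Prod.dist_eq, dist_self, Real.dist_eq, abs_of_nonneg (by linarith : 0 ≤ t - s)]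
    exact max_lt hη hlt)
  simp only [hd s hs (hst.trans ht), Real.dist_eq, sub_zero] at this
  exact (le_abs_self _).trans_lt this

/-- A path dominated by a power of a continuous control is continuous on the unit interval. -/
lemma continuousOn_of_norm_sub_le_control_rpow {E : Type*} [NormedAddCommGroup E]
    {ω : ℝ → ℝ → ℝ} {α : ℝ} (hα : 0 < α)
    (h0 : ∀ s t : ℝ, 0 ≤ s → s ≤ t → t ≤ 1 → 0 ≤ ω s t)
    (hc : ContinuousOn (fun z : ℝ × ℝ => ω z.1 z.2)
      {z : ℝ × ℝ | 0 ≤ z.1 ∧ z.1 ≤ z.2 ∧ z.2 ≤ 1})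
    (hd : ∀ s : ℝ, 0 ≤ s → s ≤ 1 → ω s s = 0) {f : ℝ → E}
    (hf : ∀ s t : ℝ, 0 ≤ s → s ≤ t → t ≤ 1 → ‖f t - f s‖ ≤ ω s t ^ α) :
    ContinuousOn f (Set.Icc 0 1) := by
  rw [Metric.continuousOn_iff]
  intro b hb ε hε
  obtain ⟨η, hη, h⟩ := exists_control_lt_near_diagonal hc hd (Real.rpow_pos_of_pos hε α⁻¹)
  have key : ∀ s t, 0 ≤ s → s ≤ t → t ≤ 1 → t - s < η → ‖f t - f s‖ < ε := by
    intro s t hs hst ht hlt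
    refine (hf s t hs hst ht).trans_lt ?_
    have := Real.rpow_lt_rpow (h0 s t hs hst ht) (h s t hs hst ht hlt) hα
    rwa [Real.rpow_inv_rpow hε.le hα.ne'] at this
  refine ⟨η, hη, fun a ha hab => ?_⟩
  rw [Real.dist_eq, abs_lt] at hab
  rcases le_total a b with hle | hle
  · rw [dist_comm, dist_eq_norm]
    exact key a b ha.1 hle hb.2 (by linarith)
  · rw [dist_eq_norm]
    exact key b a hb.1 hle ha.2 (by linarith)

/-- Sewing lemma: an almost additive continuous function on the simplex is close to the
increments of a path. -/
lemma exists_path_near_almost_additive {E : Type*} [NormedAddCommGroup E] [ProperSpace E]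
    {θ K : ℝ} (hθ : 1 < θ) (hK : 2 + 2 ^ (1 - θ) * K = K) (hK0 : 0 ≤ K) {ω : ℝ → ℝ → ℝ}
    (h0 : ∀ s t : ℝ, 0 ≤ s → s ≤ t → t ≤ 1 → 0 ≤ ω s t)
    (hc : ContinuousOn (fun z : ℝ × ℝ => ω z.1 z.2)
      {z : ℝ × ℝ | 0 ≤ z.1 ∧ z.1 ≤ z.2 ∧ z.2 ≤ 1})
    (hd : ∀ s : ℝ, 0 ≤ s → s ≤ 1 → ω s s = 0)
    (hs : ∀ s u t : ℝ, 0 ≤ s → s ≤ u → u ≤ t → t ≤ 1 → ω s u + ω u t ≤ ω s t)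
    {A : ℝ → ℝ → E}
    (hAc : ContinuousOn (fun z : ℝ × ℝ => A z.1 z.2)
      {z : ℝ × ℝ | 0 ≤ z.1 ∧ z.1 ≤ z.2 ∧ z.2 ≤ 1})
    (hA : ∀ s u t : ℝ, 0 ≤ s → s ≤ u → u ≤ t → t ≤ 1 →
      ‖A s t - A s u - A u t‖ ≤ ω s t ^ θ) :
    ∃ X : ℝ → E, ∀ s t : ℝ, 0 ≤ s → s ≤ t → t ≤ 1 →
      ‖X t - X s - A s t‖ ≤ K * ω s t ^ θ := by
  let r : ℕ → ℝ → ℝ := fun n t => (⌊t * n⌋₊ : ℝ) / n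
  let Y : ℕ → ℝ → E := fun n t =>
    ∑ i ∈ Finset.range ⌊t * n⌋₊, A ((i : ℝ) / n) (((i + 1 : ℕ) : ℝ) / n)
  have hfl : ∀ (n : ℕ) (t : ℝ), t ≤ 1 → ⌊t * n⌋₊ ≤ n := fun n t ht =>
    Nat.floor_le_of_le (by nlinarith [(Nat.cast_nonneg n : (0 : ℝ) ≤ n)])
  have hmono : ∀ (n : ℕ) (s t : ℝ), s ≤ t → ⌊s * n⌋₊ ≤ ⌊t * n⌋₊ := fun n s t hst =>
    Nat.floor_mono (mul_le_mul_of_nonneg_right hst (Nat.cast_nonneg n))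
  have hgrid0 : ∀ n i : ℕ, 0 ≤ (i : ℝ) / n := fun n i => by positivity
  have hgrid1 : ∀ n i : ℕ, i ≤ n → (i : ℝ) / n ≤ 1 := fun n i hi =>
    div_le_one_of_le₀ (by exact_mod_cast hi) (Nat.cast_nonneg n)
  have hgridm : ∀ n i j : ℕ, i ≤ j → (i : ℝ) / n ≤ (j : ℝ) / n := fun n i j hij =>
    div_le_div_of_nonneg_right (by exact_mod_cast hij) (Nat.cast_nonneg n)
  have hY : ∀ (n : ℕ) (s t : ℝ), s ≤ t → t ≤ 1 →
      ‖Y n t - Y n s - A (r n s) (r n t)‖ ≤ K * ω (r n s) (r n t) ^ θ := by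
    intro n s t hst ht
    have := norm_sum_sub_le_of_almost_additive (M := n) hθ hK hK0
      (w := fun i j => ω ((i : ℝ) / n) ((j : ℝ) / n))
      (a := fun i j => A ((i : ℝ) / n) ((j : ℝ) / n))
      (fun i j hij hj => h0 _ _ (hgrid0 n i) (hgridm n i j hij) (hgrid1 n j hj))
      (fun i hi => hd _ (hgrid0 n i) (hgrid1 n i hi))
      (fun i j m hij hjm hm => hs _ _ _ (hgrid0 n i) (hgridm n i j hij) (hgridm n j m hjm)
        (hgrid1 n m hm))
      (fun i j m hij hjm hm => hA _ _ _ (hgrid0 n i) (hgridm n i j hij) (hgridm n j m hjm)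
        (hgrid1 n m hm))
      _ ⌊s * n⌋₊ ⌊t * n⌋₊ le_rfl (hmono n s t hst) (hfl n t ht)
    rwa [Finset.sum_Ico_eq_sub _ (hmono n s t hst)] at this
  have hr : ∀ t, 0 ≤ t → Tendsto (fun n : ℕ => r n t) atTop (𝓝 t) := fun t ht =>
    (tendsto_nat_floor_mul_div_atTop ht).comp tendsto_natCast_atTop_atTop
  have hrr : ∀ s t, 0 ≤ s → s ≤ t → t ≤ 1 → Tendsto (fun n : ℕ => (r n s, r n t)) atTop
      (𝓝[{z : ℝ × ℝ | 0 ≤ z.1 ∧ z.1 ≤ z.2 ∧ z.2 ≤ 1}] (s, t)) := by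
    intro s t h0s hst ht
    refine tendsto_nhdsWithin_iff.mpr ⟨?_, ?_⟩
    · exact (hr s h0s).prodMk_nhds (hr t (h0s.trans hst))
    · exact Eventually.of_forall fun n =>
        ⟨hgrid0 _ _, hgridm _ _ _ (hmono n s t hst), hgrid1 _ _ (hfl n t ht)⟩
  have hAlim : ∀ s t, 0 ≤ s → s ≤ t → t ≤ 1 →
      Tendsto (fun n : ℕ => A (r n s) (r n t)) atTop (𝓝 (A s t)) :=
    fun s t h0s hst ht => (hAc (s, t) ⟨h0s, hst, ht⟩).tendsto.comp (hrr s t h0s hst ht)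
  have hωlim : ∀ s t, 0 ≤ s → s ≤ t → t ≤ 1 →
      Tendsto (fun n : ℕ => K * ω (r n s) (r n t) ^ θ) atTop (𝓝 (K * ω s t ^ θ)) :=
    fun s t h0s hst ht => (((hc (s, t) ⟨h0s, hst, ht⟩).tendsto.comp
      (hrr s t h0s hst ht)).rpow_const (Or.inr (by linarith))).const_mul K
  have hX : ∀ t, ∃ x : E, 0 ≤ t → t ≤ 1 →
      Tendsto (fun n => Y n t) (hyperfilter ℕ : Filter ℕ) (𝓝 x) := by
    intro t
    by_cases htt : 0 ≤ t ∧ t ≤ 1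
    swap
    · exact ⟨0, fun h h' => absurd ⟨h, h'⟩ htt⟩
    obtain ⟨ht0, ht1⟩ := htt
    have hY0 : ∀ n, Y n 0 = 0 := fun n => by simp [Y]
    have hb : ∀ n, ‖Y n t‖ ≤ K * ω (r n 0) (r n t) ^ θ + ‖A (r n 0) (r n t)‖ := by
      intro n
      have h1 := hY n 0 t ht0 ht1
      rw [hY0, sub_zero] at h1
      have h2 := norm_add_le (Y n t - A (r n 0) (r n t)) (A (r n 0) (r n t))
      rw [sub_add_cancel] at h2
      linarith
    have hlt : ∀ᶠ n : ℕ in atTop,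
        K * ω (r n 0) (r n t) ^ θ + ‖A (r n 0) (r n t)‖ < K * ω 0 t ^ θ + ‖A 0 t‖ + 1 :=
      ((hωlim 0 t le_rfl ht0 ht1).add (hAlim 0 t le_rfl ht0 ht1).norm).eventually_lt_const
        (lt_add_one _)
    have hmem : ∀ᶠ n : ℕ in (hyperfilter ℕ : Filter ℕ),
        Y n t ∈ Metric.closedBall (0 : E) (K * ω 0 t ^ θ + ‖A 0 t‖ + 1) := by
      refine Filter.Eventually.filter_mono Nat.hyperfilter_le_atTop ?_
      filter_upwards [hlt] with n hn
      rw [mem_closedBall_zero_iff]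
      exact (hb n).trans hn.le
    obtain ⟨x, -, hx⟩ := (isCompact_closedBall (0 : E) _).ultrafilter_le_nhds
      ((hyperfilter ℕ).map fun n => Y n t) (le_principal_iff.mpr hmem)
    exact ⟨x, fun _ _ => hx⟩
  choose X hX using hX
  refine ⟨X, fun s t h0s hst ht => ?_⟩
  refine le_of_tendsto_of_tendsto' (b := (hyperfilter ℕ : Filter ℕ)) ?_
    ((hωlim s t h0s hst ht).mono_left Nat.hyperfilter_le_atTop) (fun n => hY n s t hst ht)
  exact (((hX t (h0s.trans hst) ht).sub (hX s h0s (hst.trans ht))).sub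
    ((hAlim s t h0s hst ht).mono_left Nat.hyperfilter_le_atTop)).norm

/-- Along a partition, the sum of the powers of a superadditive function is controlled by its
value on the whole interval. -/
lemma sum_rpow_le_of_superadditive {ω : ℝ → ℝ → ℝ} {θ δ : ℝ} (hθ : 1 < θ) (hδ : 0 ≤ δ)
    (h0 : ∀ s t : ℝ, 0 ≤ s → s ≤ t → t ≤ 1 → 0 ≤ ω s t)
    (hs : ∀ s u t : ℝ, 0 ≤ s → s ≤ u → u ≤ t → t ≤ 1 → ω s u + ω u t ≤ ω s t)
    (τ : ℕ → ℝ) (hτ0 : 0 ≤ τ 0) (N : ℕ) (hτ : ∀ i < N, τ i ≤ τ (i + 1)) (hτN : τ N ≤ 1)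
    (hδτ : ∀ i < N, ω (τ i) (τ (i + 1)) ≤ δ) :
    τ 0 ≤ τ N ∧
      ∑ i ∈ Finset.range N, ω (τ i) (τ (i + 1)) ^ θ ≤ δ ^ (θ - 1) * ω (τ 0) (τ N) := by
  induction N with
  | zero =>
    simpa using mul_nonneg (Real.rpow_nonneg hδ _) (h0 _ _ hτ0 le_rfl hτN)
  | succ N ih =>
    have hstep := hτ N (by omega)
    obtain ⟨hle, hsum⟩ := ih (fun i hi => hτ i (by omega)) (hstep.trans hτN)
      (fun i hi => hδτ i (by omega))
    refine ⟨hle.trans hstep, ?_⟩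
    have hwN := h0 _ _ (hτ0.trans hle) hstep hτN
    have h1 : ω (τ N) (τ (N + 1)) ^ θ ≤ δ ^ (θ - 1) * ω (τ N) (τ (N + 1)) := by
      calc ω (τ N) (τ (N + 1)) ^ θ = ω (τ N) (τ (N + 1)) ^ (θ - 1 + 1) := by ring_nf
        _ = ω (τ N) (τ (N + 1)) ^ (θ - 1) * ω (τ N) (τ (N + 1)) := by
          rw [Real.rpow_add' hwN (by linarith), Real.rpow_one]
        _ ≤ _ := mul_le_mul_of_nonneg_right
          (Real.rpow_le_rpow hwN (hδτ N (by omega)) (by linarith)) hwN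
    have h2 := mul_le_mul_of_nonneg_left (hs _ _ _ hτ0 hle hstep hτN)
      (Real.rpow_nonneg hδ (θ - 1))
    rw [Finset.sum_range_succ]
    linarith

/-- Young integration: for `p, q ≥ 1` with `1/p + 1/q > 1` there is a constant
`C = C(p, q)` such that for every continuous control `ω` on the simplex and every pair
of paths `k` (matrix-valued) and `l` controlled by `ω^{1/q}` resp. `ω^{1/p}`, the
Riemann–Stieltjes sums `Σ k(t_{i−1})(l(t_i) − l(t_{i−1}))` converge (as the mesh tends
to `0`) to a Young integral `I(s,t)` satisfying
`‖I(s,t) − k(s)(l(t) − l(s))‖ ≤ C ω(s,t)^{1/p + 1/q}`. -/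
theorem young_integral_exists (p q : ℝ) (hp : 1 ≤ p) (hq : 1 ≤ q)
    (hpq : 1 < 1 / p + 1 / q) :
    ∃ C : ℝ, ∀ (d n : ℕ) (ω : ℝ → ℝ → ℝ),
      (∀ s t : ℝ, 0 ≤ s → s ≤ t → t ≤ 1 → 0 ≤ ω s t) →
      ContinuousOn (fun z : ℝ × ℝ => ω z.1 z.2)
        {z : ℝ × ℝ | 0 ≤ z.1 ∧ z.1 ≤ z.2 ∧ z.2 ≤ 1} →
      (∀ s : ℝ, 0 ≤ s → s ≤ 1 → ω s s = 0) →
      (∀ s u t : ℝ, 0 ≤ s → s ≤ u → u ≤ t → t ≤ 1 → ω s u + ω u t ≤ ω s t) →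
      ∀ (k : ℝ → EuclideanSpace ℝ (Fin d) →L[ℝ] EuclideanSpace ℝ (Fin n))
        (l : ℝ → EuclideanSpace ℝ (Fin d)),
        (∀ s t : ℝ, 0 ≤ s → s ≤ t → t ≤ 1 → ‖k t - k s‖ ≤ ω s t ^ (1 / q)) →
        (∀ s t : ℝ, 0 ≤ s → s ≤ t → t ≤ 1 → ‖l t - l s‖ ≤ ω s t ^ (1 / p)) →
        ∃ I : ℝ → ℝ → EuclideanSpace ℝ (Fin n),
          (∀ s t : ℝ, 0 ≤ s → s ≤ t → t ≤ 1 → ∀ ε : ℝ, 0 < ε → ∃ η : ℝ, 0 < η ∧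
            ∀ (N : ℕ) (τ : ℕ → ℝ), τ 0 = s → τ N = t → (∀ i < N, τ i < τ (i + 1)) →
              (∀ i < N, τ (i + 1) - τ i < η) →
              ‖(∑ i ∈ Finset.range N, k (τ i) (l (τ (i + 1)) - l (τ i))) - I s t‖ < ε) ∧
          (∀ s t : ℝ, 0 ≤ s → s ≤ t → t ≤ 1 →
            ‖I s t - k s (l t - l s)‖ ≤ C * ω s t ^ (1 / p + 1 / q)) := by
  have hp0 : 0 < 1 / p := by positivity
  have hq0 : 0 < 1 / q := by positivity
  set θ := 1 / p + 1 / q with hθdef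
  have hρ : (2 : ℝ) ^ (1 - θ) < 1 :=
    Real.rpow_lt_one_of_one_lt_of_neg (by norm_num) (by linarith)
  obtain ⟨K, hK0, hK⟩ : ∃ K : ℝ, 0 ≤ K ∧ 2 + 2 ^ (1 - θ) * K = K := by
    have h : 0 < 1 - (2 : ℝ) ^ (1 - θ) := by linarith
    refine ⟨2 / (1 - 2 ^ (1 - θ)), by positivity, ?_⟩
    field_simp
    ring
  refine ⟨K, fun d n ω h0 hc hd hs k l hk hl => ?_⟩
  have hkc := continuousOn_of_norm_sub_le_control_rpow hq0 h0 hc hd hk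
  have hlc := continuousOn_of_norm_sub_le_control_rpow hp0 h0 hc hd hl
  have hfst : MapsTo Prod.fst {z : ℝ × ℝ | 0 ≤ z.1 ∧ z.1 ≤ z.2 ∧ z.2 ≤ 1} (Set.Icc 0 1) :=
    fun z hz => ⟨hz.1, hz.2.1.trans hz.2.2⟩
  have hsnd : MapsTo Prod.snd {z : ℝ × ℝ | 0 ≤ z.1 ∧ z.1 ≤ z.2 ∧ z.2 ≤ 1} (Set.Icc 0 1) :=
    fun z hz => ⟨hz.1.trans hz.2.1, hz.2.2⟩
  obtain ⟨X, hX⟩ := exists_path_near_almost_additive (A := fun s t => k s (l t - l s))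
    hpq hK hK0 h0 hc hd hs
    ((hkc.comp continuousOn_fst hfst).clm_apply
      ((hlc.comp continuousOn_snd hsnd).sub (hlc.comp continuousOn_fst hfst)))
    (by
      intro s u t h0s hsu hut ht
      have heq : k s (l t - l s) - k s (l u - l s) - k u (l t - l u) =
          -((k u - k s) (l t - l u)) := by
        simp only [map_sub, sub_apply]
        abel
      have hsup := hs s u t h0s hsu hut ht
      have hsu0 := h0 s u h0s hsu (hut.trans ht)
      have hut0 := h0 u t (h0s.trans hsu) hut ht
      rw [heq, norm_neg]
      calc ‖(k u - k s) (l t - l u)‖ ≤ ‖k u - k s‖ * ‖l t - l u‖ :=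
            ContinuousLinearMap.le_opNorm _ _
        _ ≤ ω s t ^ (1 / q) * ω s t ^ (1 / p) := by
            refine mul_le_mul ?_ ?_ (norm_nonneg _) (Real.rpow_nonneg (by linarith) _)
            · exact (hk s u h0s hsu (hut.trans ht)).trans
                (Real.rpow_le_rpow hsu0 (by linarith) hq0.le)
            · exact (hl u t (h0s.trans hsu) hut ht).trans
                (Real.rpow_le_rpow hut0 (by linarith) hp0.le)
        _ = ω s t ^ θ := by
            rw [hθdef, Real.rpow_add' (by linarith) (by linarith), mul_comm])
  refine ⟨fun s t => X t - X s, ?_, hX⟩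
  intro s t h0s hst ht ε hε
  have hω := h0 s t h0s hst ht
  obtain ⟨δ, hδ, hδε⟩ : ∃ δ : ℝ, 0 < δ ∧ K * (δ ^ (θ - 1) * ω s t) < ε := by
    have hpos : 0 < K * ω s t + 1 := by positivity
    refine ⟨(ε / (K * ω s t + 1)) ^ (θ - 1)⁻¹, by positivity, ?_⟩
    rw [Real.rpow_inv_rpow (by positivity) (by linarith)]
    calc K * (ε / (K * ω s t + 1) * ω s t) = ε * ((K * ω s t) / (K * ω s t + 1)) := by ring
      _ < ε * 1 := mul_lt_mul_of_pos_left ((div_lt_one hpos).mpr (by linarith)) hε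
      _ = ε := mul_one ε
  obtain ⟨η, hη, hnear⟩ := exists_control_lt_near_diagonal hc hd hδ
  refine ⟨η, hη, fun N τ hτ0 hτN hτ hmesh => ?_⟩
  have hmono : ∀ i j, i ≤ j → j ≤ N → τ i ≤ τ j := by
    intro i j hij
    induction j, hij using Nat.le_induction with
    | base => exact fun _ => le_rfl
    | succ j _ ih => exact fun hj => (ih (by omega)).trans (hτ j (by omega)).le
  have hnonneg : ∀ i ≤ N, 0 ≤ τ i := fun i hi =>
    h0s.trans (hτ0.symm.le.trans (hmono 0 i (Nat.zero_le i) hi))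
  have hle1 : ∀ i ≤ N, τ i ≤ 1 := fun i hi => (hmono i N hi le_rfl).trans (hτN.le.trans ht)
  have hsum := (sum_rpow_le_of_superadditive hpq hδ.le h0 hs τ (hnonneg 0 (Nat.zero_le N)) N
    (fun i hi => (hτ i hi).le) (hle1 N le_rfl)
    (fun i hi => (hnear _ _ (hnonneg i hi.le) (hτ i hi).le (hle1 (i + 1) hi)
      (hmesh i hi)).le)).2
  have htel : X t - X s = ∑ i ∈ Finset.range N, (X (τ (i + 1)) - X (τ i)) := by
    rw [Finset.sum_range_sub (fun i => X (τ i)), hτ0, hτN]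
  calc ‖(∑ i ∈ Finset.range N, k (τ i) (l (τ (i + 1)) - l (τ i))) - (X t - X s)‖
      ≤ ∑ i ∈ Finset.range N, K * ω (τ i) (τ (i + 1)) ^ θ := by
        rw [htel, ← Finset.sum_sub_distrib]
        refine norm_sum_le_of_le _ fun i hi => ?_
        have hi := Finset.mem_range.mp hi
        rw [norm_sub_rev]
        exact hX _ _ (hnonneg i hi.le) (hτ i hi).le (hle1 (i + 1) hi)
    _ ≤ K * (δ ^ (θ - 1) * ω s t) := by
        rw [← Finset.mul_sum, ← hτ0, ← hτN]
        exact mul_le_mul_of_nonneg_left hsum hK0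
    _ < ε := hδε
end

section
/- Let f : [0,1] → ℝ be continuously differentiable. Define the cosine coefficients c_0 = ∫_0^1 f(t) dt and c_n = √2 ∫_0^1 f(t) cos(nπt) dt for n ≥ 1. Then ∫_0^1 f(t)² dt + ∫_0^1 f′(t)² dt = Σ_{n=0}^∞ c_n² + Σ_{n=1}^∞ n²π² c_n²; in particular ∫_0^1 f′(t)² dt = Σ_{n=1}^∞ n²π² c_n². -/
open Set MeasureTheory intervalIntegral

/-- Parseval's identity on `[-1, 1]` for the extension of `g` from `[0, 1]` with parity `ε = ±1`. -/
theorem hasSum_sq_norm_integral_exp_of_parity {g : ℝ → ℝ} (hg : Continuous g) {ε : ℝ}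
    (hε : ε ^ 2 = 1) :
    HasSum (fun n : ℤ => ‖(1 / 2 : ℂ) * ∫ t in (0 : ℝ)..1,
        (Complex.exp (-((n * Real.pi * t : ℝ) * Complex.I)) +
          ε * Complex.exp ((n * Real.pi * t : ℝ) * Complex.I)) * (g t : ℂ)‖ ^ 2)
      (∫ t in (0 : ℝ)..1, g t ^ 2) := by
  let G : ℝ → ℂ := (Ioi (0 : ℝ)).piecewise (fun x => (g x : ℂ)) (fun x => (ε * g (-x) : ℂ))
  have hpos : ∀ x ∈ Ioc (0 : ℝ) 1, G x = g x := fun x hx => piecewise_eq_of_mem _ _ _ hx.1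
  have hneg : ∀ x ∈ Ioc (-1 : ℝ) 0, G x = ε * g (-x) := fun x hx =>
    piecewise_eq_of_notMem _ _ _ (not_lt.mpr hx.2)
  have hmem : ∀ {h : ℝ → ℂ}, Continuous h → MemLp h 2 (volume.restrict (Ioc (-1 : ℝ) 1)) := by
    intro h hh
    obtain ⟨C, hC⟩ := isCompact_Icc.exists_bound_of_continuousOn (hh.continuousOn (s := Icc (-1) 1))
    exact MemLp.of_bound hh.aestronglyMeasurable C
      (ae_restrict_of_forall_mem measurableSet_Ioc fun x hx => hC x (Ioc_subset_Icc_self hx))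
  have hL2 : MemLp G 2 (volume.restrict (Ioc (-1 : ℝ) 1)) :=
    MemLp.piecewise measurableSet_Ioi
      ((hmem (by fun_prop)).mono_measure Measure.restrict_le_self)
      ((hmem (by fun_prop)).mono_measure Measure.restrict_le_self)
  -- an integral over `[-1, 1]` folds to one over `[0, 1]`
  have hfold : ∀ {E : Type} [NormedAddCommGroup E] [NormedSpace ℝ E] {F P Q : ℝ → E},
      Continuous P → Continuous Q → (∀ x ∈ Ioc (0 : ℝ) 1, F x = P x) →
      (∀ x ∈ Ioc (-1 : ℝ) 0, F x = Q (-x)) →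
      ∫ x in (-1 : ℝ)..1, F x = ∫ x in (0 : ℝ)..1, (P x + Q x) := by
    intro E _ _ F P Q hP hQ hFP hFQ
    have hQ' : Continuous fun x => Q (-x) := hQ.comp continuous_neg
    have e₁ : EqOn (fun x => Q (-x)) F (uIoc (-1 : ℝ) 0) := fun x hx =>
      (hFQ x (by rwa [uIoc_of_le (by norm_num)] at hx)).symm
    have e₂ : EqOn P F (uIoc (0 : ℝ) 1) := fun x hx =>
      (hFP x (by rwa [uIoc_of_le (by norm_num)] at hx)).symm
    rw [← integral_add_adjacent_intervals (b := 0)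
        ((hQ'.intervalIntegrable _ _).congr e₁) ((hP.intervalIntegrable _ _).congr e₂),
      ← intervalIntegral.integral_congr_ae (ae_of_all _ fun x hx => e₁ hx),
      ← intervalIntegral.integral_congr_ae (ae_of_all _ fun x hx => e₂ hx),
      integral_add (hP.intervalIntegrable _ _) (hQ.intervalIntegrable _ _), integral_comp_neg]
    simp [add_comm]
  convert hasSum_sq_fourierCoeffOn (by norm_num : (-1 : ℝ) < 1) hL2 using 1
  · funext n
    rw [fourierCoeffOn_eq_integral, hfold
      (P := fun t => Complex.exp (-((n * Real.pi * t : ℝ) * Complex.I)) * (g t : ℂ))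
      (Q := fun t => ε * Complex.exp ((n * Real.pi * t : ℝ) * Complex.I) * (g t : ℂ))
      (by fun_prop) (by fun_prop)]
    · simp only [← add_mul, Complex.real_smul]
      norm_num
    · intro x hx
      rw [hpos x hx, fourier_coe_apply, smul_eq_mul]
      congr 2
      push_cast
      ring
    · intro x hx
      rw [hneg x hx, fourier_coe_apply, smul_eq_mul, mul_comm (ε : ℂ) (Complex.exp _),
        mul_assoc (Complex.exp _)]
      congr 2
      push_cast
      ring
  · rw [hfold (P := fun t => g t ^ 2) (Q := fun t => g t ^ 2) (by fun_prop) (by fun_prop)]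
    · simp only [← two_mul, intervalIntegral.integral_const_mul, smul_eq_mul]
      ring
    · intro x hx
      simp [hpos x hx]
    · intro x hx
      simp [hneg x hx, mul_pow, hε]

theorem integral_congr_IccExtend (g : ℝ → ℝ) (F : ℝ → ℝ → ℝ) :
    ∫ t in (0 : ℝ)..1, F t (IccExtend zero_le_one ((Icc (0 : ℝ) 1).domRestrict g) t) =
      ∫ t in (0 : ℝ)..1, F t (g t) := by
  refine integral_congr fun t ht => ?_
  rw [uIcc_of_le zero_le_one] at ht
  simp [IccExtend_of_mem _ _ ht]

/-- Parseval's identity for the cosine system on `[0, 1]`. -/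
theorem hasSum_sq_integral_mul_cos {g : ℝ → ℝ} (hg : ContinuousOn g (Icc (0 : ℝ) 1)) :
    HasSum (fun n : ℤ => (∫ t in (0 : ℝ)..1, g t * Real.cos (n * Real.pi * t)) ^ 2)
      (∫ t in (0 : ℝ)..1, g t ^ 2) := by
  have hc : Continuous (IccExtend zero_le_one ((Icc (0 : ℝ) 1).domRestrict g)) :=
    (continuousOn_iff_continuous_domRestrict.mp hg).Icc_extend'
  convert hasSum_sq_norm_integral_exp_of_parity hc (one_pow 2) using 1
  · funext n
    rw [← integral_congr_IccExtend g fun t y => y * Real.cos (n * Real.pi * t)]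
    rw [← sq_abs, ← Real.norm_eq_abs, ← Complex.norm_real, ← intervalIntegral.integral_ofReal,
      ← intervalIntegral.integral_const_mul]
    congr 3
    funext t
    rw [← neg_mul, Complex.exp_mul_I, Complex.exp_mul_I]
    simp only [Complex.cos_neg, Complex.sin_neg]
    push_cast
    ring
  · exact (integral_congr_IccExtend g fun _ y => y ^ 2).symm

/-- Parseval's identity for the sine system on `[0, 1]`. -/
theorem hasSum_sq_integral_mul_sin {g : ℝ → ℝ} (hg : ContinuousOn g (Icc (0 : ℝ) 1)) :
    HasSum (fun n : ℤ => (∫ t in (0 : ℝ)..1, g t * Real.sin (n * Real.pi * t)) ^ 2)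
      (∫ t in (0 : ℝ)..1, g t ^ 2) := by
  have hc : Continuous (IccExtend zero_le_one ((Icc (0 : ℝ) 1).domRestrict g)) :=
    (continuousOn_iff_continuous_domRestrict.mp hg).Icc_extend'
  convert hasSum_sq_norm_integral_exp_of_parity hc (by norm_num : (-1 : ℝ) ^ 2 = 1) using 1
  · funext n
    rw [← integral_congr_IccExtend g fun t y => y * Real.sin (n * Real.pi * t)]
    rw [← sq_abs, ← Real.norm_eq_abs, ← Complex.norm_real, ← intervalIntegral.integral_ofReal,
      (fun z => by simp : ∀ z : ℂ, ‖z‖ = ‖-Complex.I * z‖),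
      ← intervalIntegral.integral_const_mul, ← intervalIntegral.integral_const_mul]
    congr 3
    funext t
    rw [← neg_mul, Complex.exp_mul_I, Complex.exp_mul_I]
    simp only [Complex.cos_neg, Complex.sin_neg]
    push_cast
    ring
  · exact (integral_congr_IccExtend g fun _ y => y ^ 2).symm

/-- Integration by parts: the boundary terms vanish because `sin (nπt)` does at `0` and `1`. -/
theorem integral_deriv_mul_sin_int_mul_pi {f f' : ℝ → ℝ}
    (hderiv : ∀ t ∈ Icc (0 : ℝ) 1, HasDerivWithinAt f (f' t) (Icc (0 : ℝ) 1) t)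
    (hcont : ContinuousOn f' (Icc (0 : ℝ) 1)) (n : ℤ) :
    ∫ t in (0 : ℝ)..1, f' t * Real.sin (n * Real.pi * t) =
      -(n * Real.pi * ∫ t in (0 : ℝ)..1, f t * Real.cos (n * Real.pi * t)) := by
  rw [← uIcc_of_le (zero_le_one' ℝ)] at hderiv hcont
  have hsin : ∀ t ∈ uIcc (0 : ℝ) 1, HasDerivWithinAt (fun t => Real.sin (n * Real.pi * t))
      (Real.cos (n * Real.pi * t) * (n * Real.pi)) (uIcc (0 : ℝ) 1) t := fun t _ => by
    simpa using (((hasDerivAt_id t).const_mul (n * Real.pi)).sin).hasDerivWithinAt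
  have hparts := integral_mul_deriv_eq_deriv_mul_of_hasDerivWithinAt hderiv hsin
    hcont.intervalIntegrable (Continuous.intervalIntegrable (by fun_prop) _ _)
  simp only [← mul_assoc, intervalIntegral.integral_mul_const, mul_one, mul_zero, Real.sin_zero,
    Real.sin_int_mul_pi] at hparts
  linarith


/-- Parseval identity for the Neumann (cosine) Fourier coefficients of a continuously
differentiable function `f` on `[0,1]`: with `c_0 = ∫_0^1 f` and
`c_n = √2 ∫_0^1 f(t) cos(nπt) dt` for `n ≥ 1`, one has
`∫_0^1 f² + ∫_0^1 f′² = Σ_{n≥0} c_n² + Σ_{n≥1} n²π² c_n²`; in particular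
`∫_0^1 f′² = Σ_{n≥1} n²π² c_n²`. -/
theorem cosine_parseval_W12
    (f f' : ℝ → ℝ)
    (hderiv : ∀ t ∈ Icc (0 : ℝ) 1, HasDerivWithinAt f (f' t) (Icc (0 : ℝ) 1) t)
    (hcont : ContinuousOn f' (Icc (0 : ℝ) 1))
    (c : ℕ → ℝ)
    (hc0 : c 0 = ∫ t in (0 : ℝ)..1, f t)
    (hcn : ∀ n : ℕ, 1 ≤ n →
      c n = Real.sqrt 2 * ∫ t in (0 : ℝ)..1, f t * Real.cos ((n : ℝ) * Real.pi * t)) :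
    ((∫ t in (0 : ℝ)..1, f t ^ 2) + ∫ t in (0 : ℝ)..1, f' t ^ 2 =
        (∑' n : ℕ, c n ^ 2) +
          ∑' n : ℕ, ((n : ℝ) + 1) ^ 2 * Real.pi ^ 2 * c (n + 1) ^ 2) ∧
      (∫ t in (0 : ℝ)..1, f' t ^ 2 =
        ∑' n : ℕ, ((n : ℝ) + 1) ^ 2 * Real.pi ^ 2 * c (n + 1) ^ 2) := by
  have hf : ContinuousOn f (Icc (0 : ℝ) 1) := fun t ht => (hderiv t ht).continuousWithinAt
  set a : ℤ → ℝ := fun n => ∫ t in (0 : ℝ)..1, f t * Real.cos (n * Real.pi * t) with ha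
  have ha_neg : ∀ n, a (-n) = a n := fun n => by simp [ha]
  have hcos := (hasSum_sq_integral_mul_cos hf).nat_add_neg
  have hsin := (hasSum_sq_integral_mul_sin hcont).nat_add_neg
  rw [← hasSum_nat_add_iff' 1] at hcos hsin
  simp only [integral_deriv_mul_sin_int_mul_pi hderiv hcont] at hsin
  change HasSum (fun n : ℕ => a (n + 1 : ℕ) ^ 2 + a (-(n + 1 : ℕ)) ^ 2) _ at hcos
  change HasSum (fun n : ℕ => (-(((n + 1 : ℕ) : ℤ) * Real.pi * a (n + 1 : ℕ))) ^ 2 +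
    (-((-((n + 1 : ℕ) : ℤ) : ℤ) * Real.pi * a (-(n + 1 : ℕ)))) ^ 2) _ at hsin
  have hsq : ∀ n : ℕ, c (n + 1) ^ 2 = 2 * a (n + 1 : ℕ) ^ 2 := fun n => by
    rw [hcn (n + 1) (by omega), mul_pow, Real.sq_sqrt zero_le_two]
    simp [ha]
  have hf' : HasSum (fun n : ℕ => ((n : ℝ) + 1) ^ 2 * Real.pi ^ 2 * c (n + 1) ^ 2)
      (∫ t in (0 : ℝ)..1, f' t ^ 2) := by
    convert hsin using 1
    · funext n
      rw [hsq, ha_neg]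
      push_cast
      ring
    · simp
  have hfc : HasSum (fun n : ℕ => c n ^ 2) (∫ t in (0 : ℝ)..1, f t ^ 2) := by
    rw [← hasSum_nat_add_iff' 1]
    convert hcos using 1
    · rfl
    · funext n
      rw [hsq, ha_neg]
      ring
    · simp [hc0]
  rw [hfc.tsum_eq, hf'.tsum_eq]
  exact ⟨rfl, rfl⟩
end
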